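/- There exist constants C₀ > 0 and Δ₀ such that for every finite simple graph G with maximum degree Δ ≥ Δ₀ and minimum degree δ ≥ Δ/4, and every assignment of a finite list of colours L_e to each edge e with |L_e| ≥ Δ + ⌊C₀·Δ^(1/2)·(log Δ)^4⌋, there exists a proper edge colouring c of G with c(e) ∈ L_e for every edge e such that S_c(u) ≠ S_c(v) for every edge uv of G. -/

import Mathlib

namespace AVD

set_option linter.unusedSectionVars false

open Finset

section ProductExpectation

variable {ι K : Type*} [Fintype ι] [DecidableEq ι] [Fintype K]

/-- Each `w i` is a probability vector on `K`. -/
structure IsProbWeight (w : ι → K → ℝ) : Prop where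
  nonneg : ∀ i k, 0 ≤ w i k
  sum_eq_one : ∀ i, ∑ k, w i k = 1

/-- The product weight of a point of `ι → K`. -/
def prodWeight (w : ι → K → ℝ) (η : ι → K) : ℝ := ∏ i, w i (η i)

/-- The expectation of `f` for the product of the weights `w i`. -/
def expect (w : ι → K → ℝ) (f : (ι → K) → ℝ) : ℝ := ∑ η, prodWeight w η * f η

/-- The expectation of `f` when only the coordinates in `T` are resampled. -/
def avg (w : ι → K → ℝ) (T : Finset ι) (f : (ι → K) → ℝ) (ω : ι → K) : ℝ :=
  expect w fun η => f (T.piecewise η ω)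

variable {w : ι → K → ℝ}

lemma expect_prod (w : ι → K → ℝ) (φ : ι → K → ℝ) :
    expect w (fun η => ∏ i, φ i (η i)) = ∏ i, ∑ k, w i k * φ i k := by
  rw [Finset.prod_univ_sum, Fintype.piFinset_univ]
  simp [expect, prodWeight, Finset.prod_mul_distrib]

lemma expect_add (f g : (ι → K) → ℝ) :
    expect w (fun η => f η + g η) = expect w f + expect w g := by
  simp [expect, mul_add, Finset.sum_add_distrib]

lemma expect_sub (f g : (ι → K) → ℝ) :
    expect w (fun η => f η - g η) = expect w f - expect w g := by
  simp [expect, mul_sub, Finset.sum_sub_distrib]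

lemma expect_const_mul (a : ℝ) (f : (ι → K) → ℝ) :
    expect w (fun η => a * f η) = a * expect w f := by
  simp only [expect, Finset.mul_sum]
  exact Finset.sum_congr rfl fun η _ => by ring

lemma expect_mul_const (a : ℝ) (f : (ι → K) → ℝ) :
    expect w (fun η => f η * a) = expect w f * a := by
  simp only [expect, Finset.sum_mul]
  exact Finset.sum_congr rfl fun η _ => by ring

lemma expect_sum {γ : Type*} (s : Finset γ) (f : γ → (ι → K) → ℝ) :
    expect w (fun η => ∑ j ∈ s, f j η) = ∑ j ∈ s, expect w (f j) := by
  simp only [expect, Finset.mul_sum]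
  exact Finset.sum_comm

namespace IsProbWeight

variable (hw : IsProbWeight w)
include hw

lemma prodWeight_nonneg (η : ι → K) : 0 ≤ prodWeight w η :=
  Finset.prod_nonneg fun i _ => hw.nonneg i _

lemma expect_const (a : ℝ) : expect w (fun _ => a) = a := by
  have h := expect_prod w (fun _ _ => (1 : ℝ))
  simp only [Finset.prod_const_one, mul_one, hw.sum_eq_one] at h
  have := expect_const_mul (w := w) a (fun _ => (1 : ℝ))
  simp only [mul_one, h] at this
  exact this

lemma expect_mono {f g : (ι → K) → ℝ} (h : ∀ η, f η ≤ g η) : expect w f ≤ expect w g :=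
  Finset.sum_le_sum fun η _ => mul_le_mul_of_nonneg_left (h η) (hw.prodWeight_nonneg η)

lemma expect_nonneg {f : (ι → K) → ℝ} (h : ∀ η, 0 ≤ f η) : 0 ≤ expect w f :=
  Finset.sum_nonneg fun η _ => mul_nonneg (hw.prodWeight_nonneg η) (h η)

lemma exists_pos {f : (ι → K) → ℝ} (h : 0 < expect w f) : ∃ η, 0 < f η := by
  by_contra! hc
  exact absurd h (not_lt.2 (Finset.sum_nonpos fun η _ =>
    mul_nonpos_of_nonneg_of_nonpos (hw.prodWeight_nonneg η) (hc η)))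

lemma expect_apply (i : ι) (g : K → ℝ) : expect w (fun η => g (η i)) = ∑ k, w i k * g k := by
  have h := expect_prod w (fun j k => if j = i then g k else 1)
  have h1 : ∀ η : ι → K, ∏ j, (if j = i then g (η j) else 1) = g (η i) := fun η => by simp
  simp only [h1] at h
  rw [h, Finset.prod_eq_single i]
  · simp
  · intro j _ hj
    simp [hj, hw.sum_eq_one]
  · simp

lemma avg_avg (S T : Finset ι) (f : (ι → K) → ℝ) (ω : ι → K) :
    avg w S (avg w T f) ω = avg w (S ∪ T) f ω := by
  let F : (ι → K) × (ι → K) → (ι → K) × (ι → K) :=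
    fun x => (T.piecewise x.2 x.1, T.piecewise x.1 x.2)
  have hF : Function.Involutive F := by
    intro x
    apply Prod.ext <;> · funext i; by_cases hi : i ∈ T <;> simp [F, hi]
  have hW : ∀ x, prodWeight w (F x).1 * prodWeight w (F x).2
      = prodWeight w x.1 * prodWeight w x.2 := by
    intro x
    simp only [prodWeight, ← Finset.prod_mul_distrib]
    refine Finset.prod_congr rfl fun i _ => ?_
    by_cases hi : i ∈ T <;> simp [F, hi, mul_comm]
  have h1 : avg w S (avg w T f) ω = ∑ x : (ι → K) × (ι → K),
      prodWeight w x.1 * prodWeight w x.2 * f ((S ∪ T).piecewise (F x).1 ω) := by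
    rw [Fintype.sum_prod_type]
    simp only [avg, expect, Finset.mul_sum]
    refine Finset.sum_congr rfl fun η _ => Finset.sum_congr rfl fun η' _ => ?_
    rw [← mul_assoc]
    congr 2
    funext i
    by_cases hi : i ∈ T <;> by_cases hi' : i ∈ S <;> simp [F, hi, hi']
  have h2 : avg w (S ∪ T) f ω = ∑ x : (ι → K) × (ι → K),
      prodWeight w x.1 * prodWeight w x.2 * f ((S ∪ T).piecewise x.1 ω) := by
    rw [Fintype.sum_prod_type]
    have hone : ∑ η', prodWeight w η' = 1 := by
      simpa [expect] using hw.expect_const 1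
    simp only [avg, expect]
    refine Finset.sum_congr rfl fun η _ => ?_
    rw [← Finset.sum_mul, ← Finset.mul_sum, hone, mul_one]
  rw [h1, h2]
  refine Fintype.sum_bijective F hF.bijective _ _ fun x => ?_
  rw [hW]

lemma expect_avg (T : Finset ι) (f : (ι → K) → ℝ) : expect w (avg w T f) = expect w f := by
  rcases isEmpty_or_nonempty (ι → K) with he | ⟨⟨ω⟩⟩
  · simp [expect]
  · have h := hw.avg_avg univ T f ω
    rw [show univ ∪ T = univ from Finset.union_eq_left.2 (Finset.subset_univ _)] at h
    simpa only [avg, Finset.piecewise_univ] using! h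

lemma expect_mul_of_dependsOn {f g : (ι → K) → ℝ} {A B : Finset ι} (hf : DependsOn f A)
    (hg : DependsOn g B) (hAB : Disjoint A B) :
    expect w (fun η => f η * g η) = expect w f * expect w g := by
  rw [← hw.expect_avg A]
  have h : ∀ ω, avg w A (fun η => f η * g η) ω = expect w f * g ω := by
    intro ω
    rw [avg, ← expect_mul_const]
    congr 1
    funext η
    congr 1
    · exact hf fun i hi => by simp [Finset.mem_coe.1 hi]
    · exact hg fun i hi => by
        simp [Finset.disjoint_right.1 hAB (Finset.mem_coe.1 hi)]
  rw [funext h, expect_const_mul]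

end IsProbWeight

lemma avg_congr {T : Finset ι} {f : (ι → K) → ℝ} {ω ω' : ι → K} (h : ∀ i ∉ T, ω i = ω' i) :
    avg w T f ω = avg w T f ω' := by
  unfold avg
  congr 1
  funext η
  congr 1
  funext i
  by_cases hi : i ∈ T <;> simp [hi, h]

end ProductExpectation

section LocalLemma

variable {ι K J : Type*} [Fintype ι] [DecidableEq ι] [Fintype K] {w : ι → K → ℝ}

open scoped Classical in
/-- The probability of an event. -/
noncomputable def prob (w : ι → K → ℝ) (A : (ι → K) → Prop) : ℝ :=
  expect w fun η => if A η then 1 else 0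

/-- The **Lovász local lemma** (asymmetric form) on a finite product space. -/
theorem exists_forall_not_of_local [Fintype J] [DecidableEq J] (hw : IsProbWeight w)
    (A : J → (ι → K) → Prop) (D : J → Finset ι) (hD : ∀ j, DependsOn (A j) (D j))
    (x : J → ℝ) (hx0 : ∀ j, 0 ≤ x j) (hx1 : ∀ j, x j < 1)
    (h : ∀ j, prob w (A j) ≤
      x j * ∏ k ∈ univ.filter (fun k => k ≠ j ∧ ¬ Disjoint (D j) (D k)), (1 - x k)) :
    ∃ ω, ∀ j, ¬ A j ω := by
  classical
  let I : J → (ι → K) → ℝ := fun j η => if A j η then 1 else 0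
  let Q : Finset J → (ι → K) → ℝ := fun S η => ∏ j ∈ S, (1 - I j η)
  have hI0 : ∀ j η, 0 ≤ I j η := fun j η => by simp only [I]; split_ifs <;> norm_num
  have hI1 : ∀ j η, 0 ≤ 1 - I j η := fun j η => by simp only [I]; split_ifs <;> norm_num
  have hI2 : ∀ j η, 1 - I j η ≤ 1 := fun j η => by linarith [hI0 j η]
  have hQ0 : ∀ S η, 0 ≤ Q S η := fun S η => Finset.prod_nonneg fun j _ => hI1 j η
  have hIdep : ∀ j, DependsOn (I j) (D j) := fun j a b hab => by
    simp only [I, hD j hab]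
  have hQins : ∀ S j, j ∉ S → expect w (Q (insert j S)) =
      expect w (Q S) - expect w (fun η => I j η * Q S η) := by
    intro S j hj
    rw [← expect_sub]
    congr 1
    funext η
    simp only [Q, Finset.prod_insert hj]
    ring
  have key : ∀ n, ∀ S : Finset J, S.card = n → ∀ j ∉ S,
      expect w (fun η => I j η * Q S η) ≤ x j * expect w (Q S) := by
    intro n
    induction n using Nat.strong_induction_on with
    | _ n ih =>
    intro S hS j hj
    let S1 := S.filter fun k => ¬ Disjoint (D j) (D k)
    let S2 := S.filter fun k => Disjoint (D j) (D k)
    have hS12 : S2 ∪ S1 = S := Finset.filter_union_filter_not_eq _ S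
    have hdisj : Disjoint S2 S1 := Finset.disjoint_filter_filter_not _ _ _
    have h1 : expect w (fun η => I j η * Q S η) ≤ expect w (fun η => I j η * Q S2 η) := by
      apply hw.expect_mono
      intro η
      apply mul_le_mul_of_nonneg_left _ (hI0 j η)
      simp only [Q]
      exact Finset.prod_le_prod_of_subset_of_le_one (Finset.filter_subset _ _) (fun k _ => hI1 k η)
        fun k _ _ => hI2 k η
    have h2 : expect w (fun η => I j η * Q S2 η) = expect w (I j) * expect w (Q S2) := by
      apply hw.expect_mul_of_dependsOn (hIdep j) (B := S2.biUnion D)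
      · intro a b hab
        simp only [Q]
        refine Finset.prod_congr rfl fun k hk => ?_
        rw [hIdep k fun i hi => hab i ?_]
        simp only [Finset.coe_biUnion, Set.mem_iUnion]
        exact ⟨k, hk, hi⟩
      · rw [Finset.disjoint_biUnion_right]
        exact fun k hk => (Finset.mem_filter.1 hk).2
    have h3 : ∀ R ⊆ S1, (∏ k ∈ R, (1 - x k)) * expect w (Q S2) ≤ expect w (Q (S2 ∪ R)) := by
      intro R
      induction R using Finset.induction_on with
      | empty => simp
      | insert k R hk ihR =>
        intro hR
        have hkS1 : k ∈ S1 := hR (Finset.mem_insert_self _ _)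
        have hR' : R ⊆ S1 := fun a ha => hR (Finset.mem_insert_of_mem ha)
        have hknot : k ∉ S2 ∪ R := by
          rw [Finset.mem_union, not_or]
          exact ⟨Finset.disjoint_right.1 hdisj hkS1, hk⟩
        have hlt : (S2 ∪ R).card < n := by
          rw [← hS, ← hS12]
          apply Finset.card_lt_card
          rw [Finset.ssubset_iff]
          refine ⟨k, hknot, ?_⟩
          rw [← Finset.union_insert]
          exact Finset.union_subset_union_right hR
        rw [Finset.union_insert, hQins _ _ hknot, Finset.prod_insert hk]
        have h4 := ih _ hlt _ rfl k hknot
        have h5 := ihR hR'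
        have h6 : 0 ≤ 1 - x k := by linarith [hx1 k]
        nlinarith [mul_le_mul_of_nonneg_left h5 h6]
    have h7 := h3 S1 subset_rfl
    rw [hS12] at h7
    have h8 : ∏ k ∈ univ.filter (fun k => k ≠ j ∧ ¬ Disjoint (D j) (D k)), (1 - x k)
        ≤ ∏ k ∈ S1, (1 - x k) := by
      apply Finset.prod_le_prod_of_subset_of_le_one
      · intro k hk
        rw [Finset.mem_filter] at hk ⊢
        exact ⟨Finset.mem_univ _, fun e => hj (e ▸ hk.1), hk.2⟩
      · intro k _
        linarith [hx1 k]
      · intro k _ _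
        linarith [hx0 k]
    have h9 : 0 ≤ expect w (Q S2) := hw.expect_nonneg (hQ0 S2)
    calc expect w (fun η => I j η * Q S η) ≤ expect w (I j) * expect w (Q S2) := h1.trans_eq h2
      _ ≤ (x j * ∏ k ∈ S1, (1 - x k)) * expect w (Q S2) :=
          mul_le_mul_of_nonneg_right
            ((h j).trans (mul_le_mul_of_nonneg_left h8 (hx0 j))) h9
      _ ≤ x j * expect w (Q S) := by
          rw [mul_assoc]
          exact mul_le_mul_of_nonneg_left h7 (hx0 j)
  have hpos : ∀ S : Finset J, 0 < expect w (Q S) := by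
    intro S
    induction S using Finset.induction_on with
    | empty => simp [Q, hw.expect_const]
    | insert j S hj ih =>
      rw [hQins S j hj]
      have h1 := key _ S rfl j hj
      nlinarith [hx1 j]
  obtain ⟨ω, hω⟩ := hw.exists_pos (hpos univ)
  refine ⟨ω, fun j hj => ?_⟩
  have : Q univ ω = 0 := Finset.prod_eq_zero (Finset.mem_univ j) (by simp [I, hj])
  linarith

end LocalLemma

section LocalLemmaCorollaries

variable {ι K J : Type*} [Fintype ι] [DecidableEq ι] [Fintype K] {w : ι → K → ℝ}

lemma IsProbWeight.prob_nonneg (hw : IsProbWeight w) (A : (ι → K) → Prop) : 0 ≤ prob w A :=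
  hw.expect_nonneg fun η => by split_ifs <;> norm_num

lemma IsProbWeight.prob_mono (hw : IsProbWeight w) {A B : (ι → K) → Prop} (h : ∀ η, A η → B η) :
    prob w A ≤ prob w B := by
  classical
  refine hw.expect_mono fun η => ?_
  by_cases hA : A η
  · simp [hA, h η hA]
  · by_cases hB : B η <;> simp [hA, hB]

lemma one_sub_sum_le_prod_one_sub {S : Finset J} {x : J → ℝ} (h0 : ∀ j ∈ S, 0 ≤ x j)
    (h1 : ∀ j ∈ S, x j ≤ 1) : 1 - ∑ j ∈ S, x j ≤ ∏ j ∈ S, (1 - x j) := by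
  classical
  induction S using Finset.induction_on with
  | empty => simp
  | insert j S hj ih =>
    rw [Finset.sum_insert hj, Finset.prod_insert hj]
    have h2 := ih (fun k hk => h0 k (Finset.mem_insert_of_mem hk))
      fun k hk => h1 k (Finset.mem_insert_of_mem hk)
    have h3 : ∏ k ∈ S, (1 - x k) ≤ 1 := Finset.prod_le_one
      (fun k hk => by linarith [h1 k (Finset.mem_insert_of_mem hk)])
      fun k hk => by linarith [h0 k (Finset.mem_insert_of_mem hk)]
    nlinarith [h0 j (Finset.mem_insert_self _ _)]

lemma sum_biUnion_le_sum_sum {α : Type*} [DecidableEq J] (s : Finset α) (T : α → Finset J)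
    {x : J → ℝ} (hx : ∀ j, 0 ≤ x j) : ∑ j ∈ s.biUnion T, x j ≤ ∑ a ∈ s, ∑ j ∈ T a, x j := by
  classical
  induction s using Finset.induction_on with
  | empty => simp
  | insert a s ha ih =>
    rw [Finset.biUnion_insert, Finset.sum_insert ha]
    have h1 := Finset.sum_union_inter (s₁ := T a) (s₂ := s.biUnion T) (f := x)
    have h2 : 0 ≤ ∑ j ∈ T a ∩ s.biUnion T, x j := Finset.sum_nonneg fun j _ => hx j
    linarith

/-- The symmetric form of the local lemma. -/
theorem exists_forall_not_of_symmetric [Fintype J] [DecidableEq J] (hw : IsProbWeight w)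
    (A : J → (ι → K) → Prop) (D : J → Finset ι) (hD : ∀ j, DependsOn (A j) (D j))
    (q : ℝ) (hq : q < 1 / 2) (d : ℝ) (hP : ∀ j, prob w (A j) ≤ q)
    (hd : ∀ j, ((univ.filter (fun k => k ≠ j ∧ ¬ Disjoint (D j) (D k))).card : ℝ) ≤ d)
    (hqd : 4 * q * d ≤ 1) :
    ∃ ω, ∀ j, ¬ A j ω := by
  rcases isEmpty_or_nonempty J with hJ | ⟨⟨j0⟩⟩
  · obtain ⟨ω, -⟩ := hw.exists_pos (f := fun _ => 1) (by rw [hw.expect_const]; norm_num)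
    exact ⟨ω, fun j => hJ.elim j⟩
  have hq0 : 0 ≤ q := (hw.prob_nonneg _).trans (hP j0)
  refine exists_forall_not_of_local hw A D hD (fun _ => 2 * q) (fun _ => by linarith)
    (fun _ => by linarith) fun j => ?_
  have h1 := one_sub_sum_le_prod_one_sub
    (S := univ.filter (fun k => k ≠ j ∧ ¬ Disjoint (D j) (D k))) (x := fun _ => 2 * q)
    (fun _ _ => by linarith) (fun _ _ => by linarith)
  rw [Finset.sum_const, nsmul_eq_mul] at h1
  have h2 : (1 : ℝ) / 2 ≤ ∏ k ∈ univ.filter (fun k => k ≠ j ∧ ¬ Disjoint (D j) (D k)),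
      (1 - 2 * q) := by
    refine le_trans ?_ h1
    nlinarith [hd j]
  nlinarith [hP j]

/-- A form of the local lemma weighted by the coordinates on which the events depend. -/
theorem exists_forall_not_of_weighted [Fintype J] [DecidableEq J] (hw : IsProbWeight w)
    (A : J → (ι → K) → Prop) (D : J → Finset ι) (hD : ∀ j, DependsOn (A j) (D j))
    (x : J → ℝ) (hx0 : ∀ j, 0 ≤ x j) (hx1 : ∀ j, x j ≤ 1 / 2)
    (hsum : ∀ i, ∑ j ∈ univ.filter (fun j => i ∈ D j), x j ≤ 1 / 2)
    (hP : ∀ j, prob w (A j) * 2 ^ (D j).card ≤ x j) :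
    ∃ ω, ∀ j, ¬ A j ω := by
  refine exists_forall_not_of_local hw A D hD x hx0 (fun j => by linarith [hx1 j]) fun j => ?_
  set N := univ.filter (fun k => k ≠ j ∧ ¬ Disjoint (D j) (D k)) with hN
  have h4 : ∀ y : ℝ, 0 ≤ y → y ≤ 1 / 2 → (4 : ℝ) ^ (-y) ≤ 1 - y := by
    intro y hy0 hy1
    have hc := (convexOn_rpow_left (b := 4) (by norm_num : (0 : ℝ) < 4)).2
      (Set.mem_univ (0 : ℝ)) (Set.mem_univ (-1 / 2 : ℝ))
      (show (0 : ℝ) ≤ 1 - 2 * y by linarith) (show (0 : ℝ) ≤ 2 * y by linarith) (by ring)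
    have h4' : (4 : ℝ) ^ (-1 / 2 : ℝ) = 1 / 2 := by
      rw [show (4 : ℝ) = 2 ^ (2 : ℝ) by norm_num, ← Real.rpow_mul (by norm_num)]
      norm_num [Real.rpow_neg_one]
    simp only [smul_eq_mul, h4', Real.rpow_zero] at hc
    calc (4 : ℝ) ^ (-y) = 4 ^ ((1 - 2 * y) * 0 + 2 * y * (-1 / 2)) := by congr 1; ring
      _ ≤ _ := hc
      _ = 1 - y := by ring
  have h1 : (4 : ℝ) ^ (-∑ k ∈ N, x k) ≤ ∏ k ∈ N, (1 - x k) := by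
    rw [← Finset.sum_neg_distrib, Real.rpow_sum_of_pos (by norm_num)]
    exact Finset.prod_le_prod (fun k _ => (Real.rpow_pos_of_pos (by norm_num) _).le)
      fun k _ => h4 _ (hx0 k) (hx1 k)
  have h2 : ∑ k ∈ N, x k ≤ (D j).card * (1 / 2) := by
    calc ∑ k ∈ N, x k
        ≤ ∑ k ∈ (D j).biUnion (fun i => univ.filter (fun k => i ∈ D k)), x k := by
          apply Finset.sum_le_sum_of_subset_of_nonneg
          · intro k hk
            obtain ⟨i, hi, hi'⟩ := Finset.not_disjoint_iff.1 (Finset.mem_filter.1 hk).2.2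
            exact Finset.mem_biUnion.2 ⟨i, hi, Finset.mem_filter.2 ⟨Finset.mem_univ _, hi'⟩⟩
          · exact fun k _ _ => hx0 k
      _ ≤ ∑ i ∈ D j, ∑ k ∈ univ.filter (fun k => i ∈ D k), x k :=
          sum_biUnion_le_sum_sum _ _ hx0
      _ ≤ ∑ i ∈ D j, (1 / 2 : ℝ) := Finset.sum_le_sum fun i _ => hsum i
      _ = (D j).card * (1 / 2) := by simp
  have h3 : ((2 : ℝ) ^ (D j).card)⁻¹ ≤ ∏ k ∈ N, (1 - x k) := by
    refine le_trans ?_ h1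
    rw [show (4 : ℝ) = 2 ^ (2 : ℝ) by norm_num, ← Real.rpow_mul (by norm_num),
      ← Real.rpow_natCast, ← Real.rpow_neg (by norm_num)]
    exact Real.rpow_le_rpow_of_exponent_le (by norm_num) (by linarith)
  have h5 : (0 : ℝ) < 2 ^ (D j).card := by positivity
  calc prob w (A j) ≤ x j * ((2 : ℝ) ^ (D j).card)⁻¹ := by
        rw [← div_eq_mul_inv, le_div_iff₀ h5]
        exact hP j
    _ ≤ _ := mul_le_mul_of_nonneg_left h3 (hx0 j)

end LocalLemmaCorollaries

section Concentration

variable {ι K : Type*} [Fintype ι] [DecidableEq ι] [Fintype K] {w : ι → K → ℝ}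

lemma sum_exp_sub_mean_le {v g : K → ℝ} {o : K} {c p l : ℝ} (hv0 : ∀ k, 0 ≤ v k)
    (hv1 : ∑ k, v k = 1) (ho : 1 - p ≤ v o) (hg : ∀ k, |g k - g o| ≤ c) (hl : 2 * |l| * c ≤ 1) :
    ∑ k, v k * Real.exp (l * (g k - ∑ k', v k' * g k')) ≤ Real.exp (l ^ 2 * (p * c ^ 2)) := by
  classical
  set m := ∑ k', v k' * g k' with hm
  have hc : 0 ≤ c := (abs_nonneg _).trans (hg o)
  have hsub : ∀ a : ℝ, m - a = ∑ k, v k * (g k - a) := by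
    intro a
    simp only [mul_sub, Finset.sum_sub_distrib, ← Finset.sum_mul, hv1, one_mul, hm]
  have hmo : |m - g o| ≤ c := by
    rw [hsub]
    calc |∑ k, v k * (g k - g o)| ≤ ∑ k, |v k * (g k - g o)| := Finset.abs_sum_le_sum_abs _ _
      _ ≤ ∑ k, v k * c := Finset.sum_le_sum fun k _ => by
          rw [abs_mul, abs_of_nonneg (hv0 k)]
          exact mul_le_mul_of_nonneg_left (hg k) (hv0 k)
      _ = c := by rw [← Finset.sum_mul, hv1, one_mul]
  have hx : ∀ k, |l * (g k - m)| ≤ 1 := by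
    intro k
    rw [abs_mul]
    have : |g k - m| ≤ 2 * c := by
      have h1 := hg k
      rw [abs_le] at *
      constructor <;> linarith
    nlinarith [abs_nonneg l]
  have h1 : ∀ k, Real.exp (l * (g k - m)) ≤ 1 + l * (g k - m) + l ^ 2 * (g k - m) ^ 2 := by
    intro k
    have := (abs_le.1 (Real.abs_exp_sub_one_sub_id_le (hx k))).2
    nlinarith
  have hzero : ∑ k, v k * (g k - m) = 0 := by rw [← hsub]; ring
  have hvar : ∑ k, v k * (g k - m) ^ 2 ≤ p * c ^ 2 := by
    have h2 : ∑ k, v k * (g k - m) ^ 2 = ∑ k, v k * (g k - g o) ^ 2 - (m - g o) ^ 2 := by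
      have h3 : ∀ k, v k * (g k - g o) ^ 2 = v k * (g k - m) ^ 2
          + 2 * (m - g o) * (v k * (g k - m)) + v k * (m - g o) ^ 2 := fun k => by ring
      simp only [h3, Finset.sum_add_distrib, ← Finset.mul_sum, hzero, ← Finset.sum_mul, hv1]
      ring
    have h4 : ∑ k, v k * (g k - g o) ^ 2 ≤ p * c ^ 2 := by
      rw [← Finset.add_sum_erase _ _ (Finset.mem_univ o)]
      have h5 : ∑ k ∈ univ.erase o, v k ≤ p := by
        have := Finset.add_sum_erase univ v (Finset.mem_univ o)
        linarith
      calc v o * (g o - g o) ^ 2 + ∑ k ∈ univ.erase o, v k * (g k - g o) ^ 2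
          ≤ 0 + ∑ k ∈ univ.erase o, v k * c ^ 2 := by
            apply add_le_add (by simp)
            refine Finset.sum_le_sum fun k _ => mul_le_mul_of_nonneg_left ?_ (hv0 k)
            exact sq_le_sq' (by linarith [(abs_le.1 (hg k)).1]) (abs_le.1 (hg k)).2
        _ ≤ p * c ^ 2 := by
            rw [zero_add, ← Finset.sum_mul]
            exact mul_le_mul_of_nonneg_right h5 (sq_nonneg c)
    nlinarith [sq_nonneg (m - g o)]
  calc ∑ k, v k * Real.exp (l * (g k - m))
      ≤ ∑ k, v k * (1 + l * (g k - m) + l ^ 2 * (g k - m) ^ 2) :=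
        Finset.sum_le_sum fun k _ => mul_le_mul_of_nonneg_left (h1 k) (hv0 k)
    _ = 1 + l ^ 2 * ∑ k, v k * (g k - m) ^ 2 := by
        have h3 : ∀ k, v k * (1 + l * (g k - m) + l ^ 2 * (g k - m) ^ 2) = v k
          + l * (v k * (g k - m)) + l ^ 2 * (v k * (g k - m) ^ 2) := fun k => by ring
        simp only [h3, Finset.sum_add_distrib, ← Finset.mul_sum, hzero, hv1]
        ring
    _ ≤ 1 + l ^ 2 * (p * c ^ 2) := by nlinarith [sq_nonneg l]
    _ ≤ _ := by linarith [Real.add_one_le_exp (l ^ 2 * (p * c ^ 2))]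

lemma IsProbWeight.avg_singleton (hw : IsProbWeight w) (i : ι) (f : (ι → K) → ℝ) (ω : ι → K) :
    avg w {i} f ω = ∑ k, w i k * f (Function.update ω i k) := by
  rw [← hw.expect_apply i, avg]
  congr 1
  funext η
  congr 1
  exact Finset.piecewise_singleton ..

lemma avg_mono (hw : IsProbWeight w) {T : Finset ι} {f g : (ι → K) → ℝ} (h : ∀ η, f η ≤ g η)
    (ω : ι → K) : avg w T f ω ≤ avg w T g ω :=
  hw.expect_mono fun _ => h _

/-- Exponential moment bound for functions with bounded influences of rare changes: every
coordinate is equal to the default value `o` with probability at least `1 - p`. -/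
theorem IsProbWeight.avg_exp_le (hw : IsProbWeight w) {o : K} {p l : ℝ}
    (hp : ∀ i, 1 - p ≤ w i o) (f : (ι → K) → ℝ) (c : ι → ℝ) (T : Finset ι)
    (hc : ∀ i ∈ T, ∀ ω, |f ω - f (Function.update ω i o)| ≤ c i)
    (hl : ∀ i ∈ T, 2 * |l| * c i ≤ 1) (ω : ι → K) :
    avg w T (fun η => Real.exp (l * (f η - avg w T f η))) ω
      ≤ Real.exp (l ^ 2 * (p * ∑ i ∈ T, c i ^ 2)) := by
  induction T using Finset.induction_on generalizing ω with
  | empty => simp [avg, hw.expect_const]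
  | insert i T hi ih =>
    have ih' := ih (fun j hj => hc j (Finset.mem_insert_of_mem hj))
      fun j hj => hl j (Finset.mem_insert_of_mem hj)
    set h := avg w T f with hh
    have hins : ∀ F ω, avg w (insert i T) F ω = avg w {i} (avg w T F) ω := by
      intro F ω
      rw [hw.avg_avg, Finset.insert_eq]
    have hinf : ∀ η, |h η - h (Function.update η i o)| ≤ c i := by
      intro η
      have e : h η - h (Function.update η i o) = expect w (fun ζ => f (T.piecewise ζ η)
          - f (Function.update (T.piecewise ζ η) i o)) := by
        rw [expect_sub, hh]
        simp only [avg]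
        congr 3
        funext ζ
        rw [Finset.update_piecewise_of_notMem T ζ η hi]
      rw [e, abs_le]
      have hb := fun ζ => abs_le.1 (hc i (Finset.mem_insert_self _ _) (T.piecewise ζ η))
      constructor
      · calc -c i = expect w (fun _ => -c i) := (hw.expect_const _).symm
          _ ≤ _ := hw.expect_mono fun ζ => (hb ζ).1
      · calc _ ≤ expect w (fun _ => c i) := hw.expect_mono fun ζ => (hb ζ).2
          _ = c i := hw.expect_const _
    have hfull : ∀ η, avg w (insert i T) f η = avg w {i} h η := fun η => hins f η
    rw [hins]
    have hinner : ∀ η, avg w T (fun ζ => Real.exp (l * (f ζ - avg w (insert i T) f ζ))) η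
        ≤ Real.exp (l ^ 2 * (p * ∑ j ∈ T, c j ^ 2)) *
          Real.exp (l * (h η - avg w {i} h η)) := by
      intro η
      have e : avg w T (fun ζ => Real.exp (l * (f ζ - avg w (insert i T) f ζ))) η =
          avg w T (fun ζ => Real.exp (l * (f ζ - h ζ))) η *
            Real.exp (l * (h η - avg w {i} h η)) := by
        simp only [avg]
        rw [← expect_mul_const]
        congr 1
        funext ζ
        rw [← Real.exp_add]
        congr 1
        have e1 : h (T.piecewise ζ η) = h η := avg_congr fun j hj => by simp [hj]
        have e2 : avg w (insert i T) f (T.piecewise ζ η) = avg w (insert i T) f η :=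
          avg_congr fun j hj => by
            rw [Finset.mem_insert, not_or] at hj
            simp [hj.2]
        change l * (f (T.piecewise ζ η) - avg w (insert i T) f (T.piecewise ζ η)) =
          l * (f (T.piecewise ζ η) - h (T.piecewise ζ η)) + l * (h η - avg w {i} h η)
        rw [e1, e2, hfull]
        ring
      rw [e]
      exact mul_le_mul_of_nonneg_right (ih' η) (Real.exp_pos _).le
    refine (avg_mono hw hinner ω).trans ?_
    rw [hw.avg_singleton]
    have e3 : ∀ k, avg w {i} h (Function.update ω i k)
        = ∑ k', w i k' * h (Function.update ω i k') := by
      intro k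
      rw [hw.avg_singleton]
      simp
    simp only [e3]
    have h6 := sum_exp_sub_mean_le (g := fun k => h (Function.update ω i k)) (hw.nonneg i)
      (hw.sum_eq_one i) (hp i) (c := c i) (fun k => by simpa using hinf (Function.update ω i k))
      (hl i (Finset.mem_insert_self _ _))
    calc _ = Real.exp (l ^ 2 * (p * ∑ j ∈ T, c j ^ 2)) * ∑ k, w i k * Real.exp (l *
          (h (Function.update ω i k) - ∑ k', w i k' * h (Function.update ω i k'))) := by
          generalize Real.exp (l ^ 2 * (p * ∑ i ∈ T, c i ^ 2)) = E
          rw [Finset.mul_sum]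
          exact Finset.sum_congr rfl fun k _ => by ring
      _ ≤ _ := mul_le_mul_of_nonneg_left h6 (Real.exp_pos _).le
      _ = _ := by
        rw [← Real.exp_add, Finset.sum_insert hi]
        congr 1
        ring

end Concentration

section Nibble

variable {ι Z : Type*} [Fintype ι] [DecidableEq ι] [Fintype Z] [DecidableEq Z]

/-- The items incident with the vertex `z`. -/
def star (inc : ι → Finset Z) (z : Z) : Finset ι := univ.filter fun i => z ∈ inc i

/-- The items other than `i` which share a vertex with `i`. -/
def nbr (inc : ι → Finset Z) (i : ι) : Finset ι :=
  univ.filter fun j => j ≠ i ∧ ¬ Disjoint (inc i) (inc j)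

/-- A linear hypergraph with edges `inc i` of size at most three and degrees at most `l`. -/
structure IsBoundedLinear (inc : ι → Finset Z) (l : ℕ) : Prop where
  pos : 0 < l
  card_le : ∀ i, (inc i).card ≤ 3
  linear : ∀ i j, i ≠ j → (inc i ∩ inc j).card ≤ 1
  star_le : ∀ z, (star inc z).card ≤ l

/-- The probability with which an item is activated. -/
noncomputable def actProb (l : ℕ) : ℝ := 1 / (8 * l)

/-- The activation weights: an item is idle (`none`), active (`some true`) or blocked
(`some false`); the weights are balanced so that all items succeed equally often. -/
noncomputable def actWeight (inc : ι → Finset Z) (l : ℕ) (i : ι) : Option Bool → ℝ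
  | none => 1 - actProb l
  | some true => actProb l * (1 - actProb l) ^ (3 * l - (nbr inc i).card)
  | some false => actProb l - actProb l * (1 - actProb l) ^ (3 * l - (nbr inc i).card)

/-- The item `i` is active and all its neighbours are idle. -/
def Succ (inc : ι → Finset Z) (ω : ι → Option Bool) (i : ι) : Prop :=
  ω i = some true ∧ ∀ j ∈ nbr inc i, ω j = none

/-- The vertex `z` belongs to a successful item. -/
def Cov (inc : ι → Finset Z) (ω : ι → Option Bool) (z : Z) : Prop :=
  ∃ i ∈ star inc z, Succ inc ω i

variable {inc : ι → Finset Z} {l : ℕ}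

lemma mem_star {z : Z} {i : ι} : i ∈ star inc z ↔ z ∈ inc i := by simp [star]

lemma mem_nbr {i j : ι} : j ∈ nbr inc i ↔ j ≠ i ∧ ¬ Disjoint (inc i) (inc j) := by simp [nbr]

lemma mem_nbr_comm {i j : ι} : j ∈ nbr inc i ↔ i ∈ nbr inc j := by
  rw [mem_nbr, mem_nbr, disjoint_comm, ne_comm]

lemma mem_nbr_of_mem {i j : ι} {z : Z} (hij : j ≠ i) (hi : z ∈ inc i) (hj : z ∈ inc j) :
    j ∈ nbr inc i :=
  mem_nbr.2 ⟨hij, Finset.not_disjoint_iff.2 ⟨z, hi, hj⟩⟩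

lemma succ_unique {ω : ι → Option Bool} {z : Z} {i j : ι} (hi : i ∈ star inc z)
    (hj : j ∈ star inc z) (h1 : Succ inc ω i) (h2 : Succ inc ω j) : i = j := by
  by_contra hij
  have := h2.2 i (mem_nbr_of_mem hij (mem_star.1 hj) (mem_star.1 hi))
  rw [h1.1] at this
  cases this

namespace IsBoundedLinear

variable (H : IsBoundedLinear inc l)
include H

lemma eq_of_mem {i j : ι} {z z' : Z} (hz : z ≠ z') (hi : z ∈ inc i) (hi' : z' ∈ inc i)
    (hj : z ∈ inc j) (hj' : z' ∈ inc j) : i = j := by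
  by_contra hij
  exact hz (Finset.card_le_one.1 (H.linear i j hij) z (Finset.mem_inter.2 ⟨hi, hj⟩) z'
    (Finset.mem_inter.2 ⟨hi', hj'⟩))

lemma card_nbr_le (i : ι) : (nbr inc i).card ≤ 3 * l := by
  calc (nbr inc i).card ≤ ((inc i).biUnion (star inc)).card := by
        refine Finset.card_le_card fun j hj => ?_
        obtain ⟨z, hz, hz'⟩ := Finset.not_disjoint_iff.1 (mem_nbr.1 hj).2
        exact Finset.mem_biUnion.2 ⟨z, hz, mem_star.2 hz'⟩
    _ ≤ (inc i).card * l := Finset.card_biUnion_le_card_mul _ _ _ fun z _ => H.star_le z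
    _ ≤ 3 * l := Nat.mul_le_mul_right _ (H.card_le i)

lemma card_star_inter_star_le {z z' : Z} (hz : z ≠ z') :
    (star inc z ∩ star inc z').card ≤ 1 := by
  refine Finset.card_le_one.2 fun i hi j hj => ?_
  simp only [Finset.mem_inter, mem_star] at hi hj
  exact H.eq_of_mem hz hi.1 hi.2 hj.1 hj.2

lemma card_nbr_inter_nbr_le {i j : ι} (hij : Disjoint (inc i) (inc j)) :
    (nbr inc i ∩ nbr inc j).card ≤ 9 := by
  calc (nbr inc i ∩ nbr inc j).card
      ≤ ((inc i ×ˢ inc j).biUnion fun x => star inc x.1 ∩ star inc x.2).card := by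
        refine Finset.card_le_card fun k hk => ?_
        rw [Finset.mem_inter, mem_nbr, mem_nbr] at hk
        obtain ⟨z, hz, hz'⟩ := Finset.not_disjoint_iff.1 hk.1.2
        obtain ⟨y, hy, hy'⟩ := Finset.not_disjoint_iff.1 hk.2.2
        exact Finset.mem_biUnion.2 ⟨(z, y), Finset.mem_product.2 ⟨hz, hy⟩,
          Finset.mem_inter.2 ⟨mem_star.2 hz', mem_star.2 hy'⟩⟩
    _ ≤ (inc i ×ˢ inc j).card * 1 := by
        refine Finset.card_biUnion_le_card_mul _ _ _ fun x hx => ?_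
        rw [Finset.mem_product] at hx
        exact H.card_star_inter_star_le (Finset.disjoint_iff_ne.1 hij _ hx.1 _ hx.2)
    _ ≤ 9 := by
        rw [Finset.card_product, mul_one]
        exact Nat.mul_le_mul (H.card_le i) (H.card_le j)

lemma card_star_inter_nbr_le {i : ι} {z : Z} (hz : z ∉ inc i) :
    (star inc z ∩ nbr inc i).card ≤ 3 := by
  calc (star inc z ∩ nbr inc i).card
      ≤ ((inc i).biUnion fun y => star inc z ∩ star inc y).card := by
        refine Finset.card_le_card fun k hk => ?_
        rw [Finset.mem_inter, mem_nbr] at hk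
        obtain ⟨y, hy, hy'⟩ := Finset.not_disjoint_iff.1 hk.2.2
        exact Finset.mem_biUnion.2 ⟨y, hy, Finset.mem_inter.2 ⟨hk.1, mem_star.2 hy'⟩⟩
    _ ≤ (inc i).card * 1 := by
        refine Finset.card_biUnion_le_card_mul _ _ _ fun y hy => ?_
        exact H.card_star_inter_star_le fun h => hz (h ▸ hy)
    _ ≤ 3 := by
        rw [mul_one]
        exact H.card_le i

lemma actProb_pos : 0 < actProb l := by
  have : (0 : ℝ) < l := by exact_mod_cast H.pos
  unfold actProb
  positivity

lemma mul_actProb : (l : ℝ) * actProb l = 1 / 8 := by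
  have : (0 : ℝ) < l := by exact_mod_cast H.pos
  unfold actProb
  field_simp

lemma actProb_le : actProb l ≤ 1 / 8 := by
  have h := H.mul_actProb
  have h1 : (1 : ℝ) ≤ l := by exact_mod_cast H.pos
  nlinarith [H.actProb_pos]

lemma isProbWeight : IsProbWeight (actWeight inc l) := by
  have h0 := H.actProb_pos
  have h1 := H.actProb_le
  constructor
  · intro i k
    have h2 : (1 - actProb l) ^ (3 * l - (nbr inc i).card) ≤ 1 :=
      pow_le_one₀ (by linarith) (by linarith)
    have h3 : 0 < (1 - actProb l) ^ (3 * l - (nbr inc i).card) := pow_pos (by linarith) _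
    rcases k with _ | _ | _
    · change (0 : ℝ) ≤ 1 - actProb l
      linarith
    · change 0 ≤ actProb l - actProb l * (1 - actProb l) ^ (3 * l - (nbr inc i).card)
      nlinarith
    · change 0 ≤ actProb l * (1 - actProb l) ^ (3 * l - (nbr inc i).card)
      positivity
  · intro i
    rw [Fintype.sum_option, Fintype.sum_bool]
    simp only [actWeight]
    ring

end IsBoundedLinear

/-- The success probability of an item. -/
noncomputable def succProb (l : ℕ) : ℝ := actProb l * (1 - actProb l) ^ (3 * l)

open scoped Classical in
/-- The indicator of success of an item. -/
noncomputable def succInd (inc : ι → Finset Z) (i : ι) (ω : ι → Option Bool) : ℝ :=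
  if Succ inc ω i then 1 else 0

open scoped Classical in
/-- The indicator of a vertex being uncovered. -/
noncomputable def uncInd (inc : ι → Finset Z) (z : Z) (ω : ι → Option Bool) : ℝ :=
  if Cov inc ω z then 0 else 1

open scoped Classical in
lemma expect_pattern (w : ι → Option Bool → ℝ) (hw : IsProbWeight w) {A B : Finset ι}
    (hAB : Disjoint A B) :
    expect w (fun ω => if (∀ i ∈ A, ω i = some true) ∧ ∀ i ∈ B, ω i = none then 1 else 0)
      = (∏ i ∈ A, w i (some true)) * ∏ i ∈ B, w i none := by
  let φ : ι → Option Bool → ℝ := fun i k =>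
    if i ∈ A then (if k = some true then 1 else 0) else
      if i ∈ B then (if k = none then 1 else 0) else 1
  have h1 : (fun ω : ι → Option Bool =>
      if (∀ i ∈ A, ω i = some true) ∧ ∀ i ∈ B, ω i = none then (1 : ℝ) else 0)
      = fun ω => ∏ i, φ i (ω i) := by
    funext ω
    split_ifs with h
    · refine (Finset.prod_eq_one fun i _ => ?_).symm
      by_cases hA : i ∈ A
      · simp [φ, hA, h.1 i hA]
      · by_cases hB : i ∈ B
        · simp [φ, hA, hB, h.2 i hB]
        · simp [φ, hA, hB]
    · rw [not_and_or] at h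
      push Not at h
      rcases h with ⟨i, hi, h⟩ | ⟨i, hi, h⟩
      · exact (Finset.prod_eq_zero (Finset.mem_univ i) (by simp [φ, hi, h])).symm
      · exact (Finset.prod_eq_zero (Finset.mem_univ i)
          (by simp [φ, hi, h, Finset.disjoint_right.1 hAB hi])).symm
  rw [h1, expect_prod]
  have h2 : ∀ i, ∑ k, w i k * φ i k =
      (if i ∈ A then w i (some true) else 1) * (if i ∈ B then w i none else 1) := by
    intro i
    by_cases hA : i ∈ A
    · simp [φ, hA, Finset.disjoint_left.1 hAB hA]
    · by_cases hB : i ∈ B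
      · simp [φ, hA, hB]
      · have := hw.sum_eq_one i
        simp only [φ, hA, hB, if_false, mul_one, this]
  simp only [h2, Finset.prod_mul_distrib]
  congr 1 <;> simp

namespace IsBoundedLinear

variable (H : IsBoundedLinear inc l)
include H

lemma succProb_pos : 0 < succProb l :=
  mul_pos H.actProb_pos (pow_pos (by linarith [H.actProb_le]) _)

lemma succProb_le : succProb l ≤ actProb l :=
  mul_le_of_le_one_right H.actProb_pos.le
    (pow_le_one₀ (by linarith [H.actProb_le]) (by linarith [H.actProb_pos]))

lemma le_mul_succProb : 5 / 64 ≤ l * succProb l := by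
  have h := one_add_mul_le_pow (a := -actProb l) (by linarith [H.actProb_le]) (3 * l)
  have h1 := H.mul_actProb
  rw [succProb, ← mul_assoc, h1]
  push_cast at h
  have h2 : (5 : ℝ) / 8 ≤ (1 - actProb l) ^ (3 * l) := by
    rw [sub_eq_add_neg]
    linarith
  linarith

lemma mul_succProb_le : l * succProb l ≤ 1 / 8 := by
  rw [← H.mul_actProb]
  exact mul_le_mul_of_nonneg_left H.succProb_le (Nat.cast_nonneg l)

lemma expect_succInd (i : ι) : expect (actWeight inc l) (succInd inc i) = succProb l := by
  classical
  have h := expect_pattern (actWeight inc l) H.isProbWeight (A := {i}) (B := nbr inc i)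
    (by simp [mem_nbr])
  simp only [Finset.mem_singleton, forall_eq, Finset.prod_singleton] at h
  have h2 : (1 - actProb l) ^ (3 * l) = (1 - actProb l) ^ (3 * l - (nbr inc i).card) *
      (1 - actProb l) ^ (nbr inc i).card := by
    rw [← pow_add, Nat.sub_add_cancel (H.card_nbr_le i)]
  have h3 : succInd inc i = fun ω => if ω i = some true ∧ ∀ j ∈ nbr inc i, ω j = none
      then (1 : ℝ) else 0 := by
    funext ω
    unfold succInd Succ
    congr
  rw [h3, h]
  simp only [actWeight, Finset.prod_const, succProb]
  rw [h2]
  ring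

lemma expect_succInd_mul {i j : ι} (hij : i ≠ j) (hd : Disjoint (inc i) (inc j)) :
    |expect (actWeight inc l) (fun ω => succInd inc i ω * succInd inc j ω) - succProb l ^ 2|
      ≤ 9 * actProb l ^ 3 := by
  classical
  have hnj : j ∉ nbr inc i := fun h => (mem_nbr.1 h).2 hd
  have hni : i ∉ nbr inc j := fun h => hnj (mem_nbr_comm.1 h)
  have h := expect_pattern (actWeight inc l) H.isProbWeight (A := {i, j})
    (B := nbr inc i ∪ nbr inc j) (by
      rw [Finset.disjoint_left]
      intro k hk hk'
      rw [Finset.mem_insert, Finset.mem_singleton] at hk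
      rw [Finset.mem_union] at hk'
      rcases hk with rfl | rfl
      · rcases hk' with h | h
        · exact (mem_nbr.1 h).1 rfl
        · exact hni h
      · rcases hk' with h | h
        · exact hnj h
        · exact (mem_nbr.1 h).1 rfl)
  set P := expect (actWeight inc l) (fun ω => succInd inc i ω * succInd inc j ω) with hP
  have hP' : P = expect (actWeight inc l) (fun ω => if (∀ k ∈ ({i, j} : Finset ι), ω k = some true)
      ∧ ∀ k ∈ nbr inc i ∪ nbr inc j, ω k = none then 1 else 0) := by
    rw [hP]
    congr 1
    funext ω
    have e : succInd inc i ω * succInd inc j ω =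
        if Succ inc ω i ∧ Succ inc ω j then 1 else 0 := by
      by_cases h1 : Succ inc ω i <;> by_cases h2 : Succ inc ω j <;> simp [succInd, h1, h2]
    rw [e]
    refine if_congr ?_ rfl rfl
    simp only [Succ, Finset.mem_insert, Finset.mem_singleton, forall_eq,
      Finset.mem_union, or_imp, forall_and]
    tauto
  rw [← hP', Finset.prod_pair hij] at h
  simp only [actWeight, Finset.prod_const] at h
  have hp0 := H.actProb_pos
  have hp1 := H.actProb_le
  set p := actProb l with hp
  set m := (nbr inc i ∩ nbr inc j).card with hm
  have hm9 : m ≤ 9 := H.card_nbr_inter_nbr_le hd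
  have hc := Finset.card_union_add_card_inter (nbr inc i) (nbr inc j)
  have hci := H.card_nbr_le i
  have hcj := H.card_nbr_le j
  have h1 : P = p ^ 2 * (1 - p) ^ (6 * l - m) := by
    rw [h]
    have : 6 * l - m = (3 * l - (nbr inc i).card) + (3 * l - (nbr inc j).card)
      + (nbr inc i ∪ nbr inc j).card := by omega
    rw [this, pow_add, pow_add]
    ring
  have h2 : P * (1 - p) ^ m = succProb l ^ 2 := by
    rw [h1, mul_assoc, ← pow_add, succProb, mul_pow, ← pow_mul]
    congr 2
    have : m ≤ (nbr inc i).card := Finset.card_le_card Finset.inter_subset_left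
    omega
  have h3 : P ≤ p ^ 2 := by
    rw [h1]
    exact mul_le_of_le_one_right (by positivity) (pow_le_one₀ (by linarith) (by linarith))
  have h4 : 0 ≤ P := by
    rw [h1]
    exact mul_nonneg (by positivity) (pow_nonneg (by linarith) _)
  have h5 : 1 - 9 * p ≤ (1 - p) ^ m := by
    have := one_add_mul_le_pow (a := -p) (by linarith) m
    rw [← sub_eq_add_neg] at this
    have h9 : (m : ℝ) ≤ 9 := by exact_mod_cast hm9
    nlinarith
  have h6 : (1 - p) ^ m ≤ 1 := pow_le_one₀ (by linarith) (by linarith)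
  rw [abs_le]
  constructor <;> nlinarith

lemma expect_succInd_mul_of_mem_nbr {i j : ι} (hij : j ∈ nbr inc i) :
    expect (actWeight inc l) (fun ω => succInd inc i ω * succInd inc j ω) = 0 := by
  rw [← H.isProbWeight.expect_const 0]
  congr 1
  funext ω
  by_cases h : Succ inc ω i
  · have : ¬ Succ inc ω j := fun h' => by
      have := h.2 j hij
      rw [h'.1] at this
      cases this
    simp [succInd, this]
  · simp [succInd, h]

end IsBoundedLinear

lemma succInd_mul_self (i : ι) (ω : ι → Option Bool) :
    succInd inc i ω * succInd inc i ω = succInd inc i ω := by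
  unfold succInd
  split_ifs <;> norm_num

lemma uncInd_eq (z : Z) (ω : ι → Option Bool) :
    uncInd inc z ω = 1 - ∑ i ∈ star inc z, succInd inc i ω := by
  classical
  by_cases h : Cov inc ω z
  · obtain ⟨i, hi, hs⟩ := h
    rw [Finset.sum_eq_single_of_mem i hi]
    · simp [uncInd, succInd, hs, show Cov inc ω z from ⟨i, hi, hs⟩]
    · intro j hj hji
      have : ¬ Succ inc ω j := fun h => hji (succ_unique hj hi h hs)
      simp [succInd, this]
  · rw [Finset.sum_eq_zero]
    · simp [uncInd, h]
    · intro j hj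
      have : ¬ Succ inc ω j := fun h' => h ⟨j, hj, h'⟩
      simp [succInd, this]

namespace IsBoundedLinear

variable (H : IsBoundedLinear inc l)
include H

lemma expect_uncInd (z : Z) :
    expect (actWeight inc l) (uncInd inc z) = 1 - (star inc z).card * succProb l := by
  rw [show uncInd inc z = fun ω => 1 - ∑ i ∈ star inc z, succInd inc i ω from
    funext (uncInd_eq z), expect_sub, H.isProbWeight.expect_const, expect_sum]
  simp [H.expect_succInd]

lemma expect_uncInd_mul {z z' : Z} (hz : z ≠ z') :
    |expect (actWeight inc l) (fun ω => uncInd inc z ω * uncInd inc z' ω) -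
      (1 - (star inc z).card * succProb l) * (1 - (star inc z').card * succProb l)|
      ≤ 2 * actProb l := by
  classical
  set w := actWeight inc l with hw
  set s := succProb l with hs
  have hp0 := H.actProb_pos
  have hs0 := H.succProb_pos
  have hs1 := H.succProb_le
  have hlp := H.mul_actProb
  set p := actProb l with hp
  have h1 : expect w (fun ω => uncInd inc z ω * uncInd inc z' ω) =
      1 - (star inc z).card * s - (star inc z').card * s +
        ∑ i ∈ star inc z, ∑ j ∈ star inc z', expect w (fun ω => succInd inc i ω *
          succInd inc j ω) := by
    have e : (fun ω => uncInd inc z ω * uncInd inc z' ω) = fun ω =>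
        (uncInd inc z ω - ∑ i ∈ star inc z', succInd inc i ω) +
          ∑ i ∈ star inc z, ∑ j ∈ star inc z', succInd inc i ω * succInd inc j ω := by
      funext ω
      rw [← Finset.sum_mul_sum, uncInd_eq, uncInd_eq]
      ring
    rw [e, expect_add, expect_sub, H.expect_uncInd, expect_sum, expect_sum,
      Finset.sum_congr rfl fun j _ => H.expect_succInd j]
    simp [expect_sum, hs]
  have h2 : expect w (fun ω => uncInd inc z ω * uncInd inc z' ω) -
      (1 - (star inc z).card * s) * (1 - (star inc z').card * s) =
      ∑ i ∈ star inc z, ∑ j ∈ star inc z', (expect w (fun ω => succInd inc i ω *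
          succInd inc j ω) - s ^ 2) := by
    rw [h1]
    simp only [Finset.sum_sub_distrib, Finset.sum_const, nsmul_eq_mul]
    ring
  have h3 : ∀ i ∈ star inc z, ∀ j ∈ star inc z', |expect w (fun ω => succInd inc i ω *
      succInd inc j ω) - s ^ 2| ≤ (if i = j then p else 0) +
        (if j ∈ nbr inc i then p ^ 2 else 0) + 9 * p ^ 3 := by
    intro i _ j _
    have hp3 : 0 < p ^ 3 := by positivity
    by_cases hij : i = j
    · subst hij
      have : i ∉ nbr inc i := fun h => (mem_nbr.1 h).1 rfl
      simp only [succInd_mul_self, if_true, this, if_false]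
      rw [H.expect_succInd, abs_le]
      have : p ≤ 1 := by linarith [H.actProb_le]
      constructor <;> nlinarith
    · by_cases hn : j ∈ nbr inc i
      · rw [H.expect_succInd_mul_of_mem_nbr hn, if_neg hij, if_pos hn, zero_sub, abs_neg,
          abs_of_nonneg (sq_nonneg s)]
        nlinarith
      · rw [if_neg hij, if_neg hn]
        have hd : Disjoint (inc i) (inc j) := by
          by_contra h
          exact hn (mem_nbr.2 ⟨Ne.symm hij, h⟩)
        linarith [H.expect_succInd_mul hij hd]
  have hl : ∀ y, ((star inc y).card : ℝ) ≤ l := fun y => by exact_mod_cast H.star_le y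
  have h4 : ∑ i ∈ star inc z, ∑ j ∈ star inc z', (if i = j then p else 0) ≤ p := by
    simp only [Finset.sum_ite_eq]
    rw [← Finset.sum_filter, Finset.filter_mem_eq_inter, Finset.sum_const, nsmul_eq_mul]
    have : ((star inc z ∩ star inc z').card : ℝ) ≤ 1 := by
      exact_mod_cast H.card_star_inter_star_le hz
    nlinarith
  have h5 : ∑ i ∈ star inc z, ∑ j ∈ star inc z', (if j ∈ nbr inc i then p ^ 2 else 0)
      ≤ 4 * l * p ^ 2 := by
    have h51 : ∀ i ∈ star inc z, ∑ j ∈ star inc z', (if j ∈ nbr inc i then p ^ 2 else 0)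
        ≤ 3 * p ^ 2 + if i ∈ star inc z' then l * p ^ 2 else 0 := by
      intro i _
      rw [← Finset.sum_filter, Finset.filter_mem_eq_inter, Finset.sum_const, nsmul_eq_mul]
      split_ifs with hi
      · have : ((star inc z' ∩ nbr inc i).card : ℝ) ≤ l := le_trans (by
          exact_mod_cast Finset.card_le_card Finset.inter_subset_left) (hl z')
        nlinarith [sq_nonneg p]
      · have : ((star inc z' ∩ nbr inc i).card : ℝ) ≤ 3 := by
          exact_mod_cast H.card_star_inter_nbr_le fun h => hi (mem_star.2 h)
        nlinarith [sq_nonneg p]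
    refine (Finset.sum_le_sum h51).trans ?_
    rw [Finset.sum_add_distrib, ← Finset.sum_filter, Finset.filter_mem_eq_inter, Finset.sum_const,
      Finset.sum_const, nsmul_eq_mul, nsmul_eq_mul]
    have h52 : ((star inc z ∩ star inc z').card : ℝ) ≤ 1 := by
      exact_mod_cast H.card_star_inter_star_le hz
    have h53 : 0 ≤ l * p ^ 2 := by positivity
    nlinarith [hl z, sq_nonneg p]
  rw [h2]
  calc _ ≤ ∑ i ∈ star inc z, ∑ j ∈ star inc z', |expect w (fun ω => succInd inc i ω *
          succInd inc j ω) - s ^ 2| :=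
        (Finset.abs_sum_le_sum_abs _ _).trans
          (Finset.sum_le_sum fun i _ => Finset.abs_sum_le_sum_abs _ _)
    _ ≤ ∑ i ∈ star inc z, ∑ j ∈ star inc z', ((if i = j then p else 0) +
        (if j ∈ nbr inc i then p ^ 2 else 0) + 9 * p ^ 3) :=
        Finset.sum_le_sum fun i hi => Finset.sum_le_sum fun j hj => h3 i hi j hj
    _ ≤ p + 4 * l * p ^ 2 + l * l * (9 * p ^ 3) := by
        simp only [Finset.sum_add_distrib]
        refine add_le_add (add_le_add h4 h5) ?_
        simp only [Finset.sum_const, nsmul_eq_mul]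
        rw [← mul_assoc]
        refine mul_le_mul_of_nonneg_right ?_ (by positivity)
        exact mul_le_mul (hl z) (hl z') (Nat.cast_nonneg _) (Nat.cast_nonneg _)
    _ = p + 4 * (l * p) * p + 9 * (l * p) ^ 2 * p := by ring
    _ ≤ 2 * p := by
        rw [hlp]
        nlinarith

end IsBoundedLinear

end Nibble

section Survivors

variable {ι Z κ : Type*} [Fintype ι] [DecidableEq ι] [Fintype Z] [DecidableEq Z]
  {inc : ι → Finset Z} {l : ℕ}

/-- The number of sets `A k` with `k ∈ F` all of whose vertices are uncovered. -/
noncomputable def surv (inc : ι → Finset Z) (F : Finset κ) (A : κ → Finset Z)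
    (ω : ι → Option Bool) : ℝ :=
  ∑ k ∈ F, ∏ z ∈ A k, uncInd inc z ω

/-- The items incident with the sets `A k`, `k ∈ F`. -/
def block (inc : ι → Finset Z) (F : Finset κ) (A : κ → Finset Z) : Finset ι :=
  (F.biUnion A).biUnion (star inc)

/-- The items in the block and their neighbours. -/
def wideBlock (inc : ι → Finset Z) (F : Finset κ) (A : κ → Finset Z) : Finset ι :=
  block inc F A ∪ (block inc F A).biUnion (nbr inc)

lemma uncInd_congr {ω ω' : ι → Option Bool} {z : Z}
    (h : ∀ i ∈ star inc z, Succ inc ω i ↔ Succ inc ω' i) : uncInd inc z ω = uncInd inc z ω' := by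
  classical
  unfold uncInd
  refine if_congr ?_ rfl rfl
  exact exists_congr fun i => and_congr_right fun hi => h i hi

lemma uncInd_eq_zero_or_one (z : Z) (ω : ι → Option Bool) :
    uncInd inc z ω = 0 ∨ uncInd inc z ω = 1 := by
  unfold uncInd
  split_ifs <;> simp

lemma mem_block {F : Finset κ} {A : κ → Finset Z} {k : κ} {z : Z} {i : ι} (hk : k ∈ F)
    (hz : z ∈ A k) (hi : i ∈ star inc z) : i ∈ block inc F A :=
  Finset.mem_biUnion.2 ⟨z, Finset.mem_biUnion.2 ⟨k, hk, hz⟩, hi⟩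

lemma surv_congr {F : Finset κ} {A : κ → Finset Z} {ω ω' : ι → Option Bool}
    (h : ∀ i ∈ block inc F A, Succ inc ω i ↔ Succ inc ω' i) :
    surv inc F A ω = surv inc F A ω' :=
  Finset.sum_congr rfl fun _ hk => Finset.prod_congr rfl fun _ hz =>
    uncInd_congr fun i hi => h i (mem_block hk hz hi)

lemma surv_dependsOn (F : Finset κ) (A : κ → Finset Z) :
    DependsOn (surv inc F A) (wideBlock inc F A) := by
  intro ω ω' h
  refine surv_congr fun i hi => ?_
  unfold Succ
  rw [h i (Finset.mem_coe.2 (Finset.mem_union_left _ hi))]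
  refine and_congr_right fun _ => forall₂_congr fun j hj => ?_
  rw [h j (Finset.mem_coe.2 (Finset.mem_union_right _ (Finset.mem_biUnion.2 ⟨i, hi, hj⟩)))]

lemma succ_update_iff {ω : ι → Option Bool} {i j : ι} (hj : j ≠ i) (hn : j ∉ nbr inc i)
    (k : Option Bool) : Succ inc ω j ↔ Succ inc (Function.update ω i k) j := by
  unfold Succ
  rw [Function.update_of_ne hj]
  refine and_congr_right fun _ => forall₂_congr fun j' hj' => ?_
  rw [Function.update_of_ne]
  rintro rfl
  exact hn (mem_nbr_comm.1 hj')

lemma surv_update_of_forall_idle {F : Finset κ} {A : κ → Finset Z} {ω : ι → Option Bool} {i : ι}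
    (hi : i ∉ block inc F A) (h : ∀ j ∈ nbr inc i, j ∈ block inc F A → ω j = none)
    (k : Option Bool) : surv inc F A ω = surv inc F A (Function.update ω i k) := by
  refine surv_congr fun j hj => ?_
  have hji : j ≠ i := fun e => hi (e ▸ hj)
  by_cases hn : j ∈ nbr inc i
  · unfold Succ
    rw [Function.update_of_ne hji, h j hn hj]
    simp
  · exact succ_update_iff hji hn k

lemma abs_prod_sub_prod_le {s : Finset Z} {a b : Z → ℝ} (C : Finset Z)
    (ha : ∀ z, a z = 0 ∨ a z = 1) (hb : ∀ z, b z = 0 ∨ b z = 1)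
    (h : ∀ z, z ∉ C → a z = b z) : |∏ z ∈ s, a z - ∏ z ∈ s, b z| ≤ (s ∩ C).card := by
  have h01 : ∀ c : Z → ℝ, (∀ z, c z = 0 ∨ c z = 1) → 0 ≤ ∏ z ∈ s, c z ∧ ∏ z ∈ s, c z ≤ 1 := by
    intro c hc
    constructor
    · exact Finset.prod_nonneg fun z _ => by rcases hc z with e | e <;> simp [e]
    · exact Finset.prod_le_one (fun z _ => by rcases hc z with e | e <;> simp [e])
        fun z _ => by rcases hc z with e | e <;> simp [e]
  by_cases hs : s ∩ C = ∅
  · rw [Finset.prod_congr rfl fun z hz => h z fun hC => by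
      have := Finset.mem_inter.2 ⟨hz, hC⟩
      rw [hs] at this
      simp at this]
    simp
  · have h1 : (1 : ℝ) ≤ (s ∩ C).card := by
      exact_mod_cast Finset.card_pos.2 (Finset.nonempty_iff_ne_empty.2 hs)
    have h2 := h01 a ha
    have h3 := h01 b hb
    rw [abs_le]
    constructor <;> linarith

namespace IsBoundedLinear

variable (H : IsBoundedLinear inc l)
include H

lemma card_uncInd_update_ne_le (ω : ι → Option Bool) (i : ι) :
    (univ.filter fun z => uncInd inc z ω ≠ uncInd inc z (Function.update ω i none)).card ≤ 12 := by
  classical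
  set ω' := Function.update ω i none with hω'
  set G := (nbr inc i).filter (Succ inc ω') with hG
  have hGcard : G.card ≤ 3 := by
    calc G.card ≤ ((inc i).biUnion fun z => (star inc z).filter (Succ inc ω')).card := by
          refine Finset.card_le_card fun j hj => ?_
          rw [hG, Finset.mem_filter, mem_nbr] at hj
          obtain ⟨z, hz, hz'⟩ := Finset.not_disjoint_iff.1 hj.1.2
          exact Finset.mem_biUnion.2 ⟨z, hz, Finset.mem_filter.2 ⟨mem_star.2 hz', hj.2⟩⟩
      _ ≤ (inc i).card * 1 := by
          refine Finset.card_biUnion_le_card_mul _ _ _ fun z _ => ?_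
          refine Finset.card_le_one.2 fun j hj j' hj' => ?_
          rw [Finset.mem_filter] at hj hj'
          exact succ_unique hj.1 hj'.1 hj.2 hj'.2
      _ ≤ 3 := by
          rw [mul_one]
          exact H.card_le i
  calc _ ≤ ((insert i G).biUnion inc).card := by
        refine Finset.card_le_card fun z hz => ?_
        rw [Finset.mem_filter] at hz
        obtain ⟨j, hj, hne⟩ : ∃ j ∈ star inc z, ¬ (Succ inc ω j ↔ Succ inc ω' j) := by
          by_contra! hc
          exact hz.2 (uncInd_congr hc)
        refine Finset.mem_biUnion.2 ⟨j, ?_, mem_star.1 hj⟩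
        by_cases hji : j = i
        · exact hji ▸ Finset.mem_insert_self _ _
        · have hn : j ∈ nbr inc i := by
            by_contra hn
            exact hne (succ_update_iff hji hn none)
          refine Finset.mem_insert_of_mem (Finset.mem_filter.2 ⟨hn, ?_⟩)
          by_contra hs
          apply hne
          refine iff_of_false (fun hs' => ?_) hs
          have h1 := hs'.2 i (mem_nbr_comm.1 hn)
          have h2 : ω' = ω := by
            rw [hω', ← h1, Function.update_eq_self]
          exact hs (h2 ▸ hs')
    _ ≤ (insert i G).card * 3 :=
        Finset.card_biUnion_le_card_mul _ _ _ fun j _ => H.card_le j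
    _ ≤ 12 := by
        have := Finset.card_insert_le i G
        omega

lemma abs_surv_sub_update_le {F : Finset κ} {A : κ → Finset Z}
    (hA : (F : Set κ).PairwiseDisjoint A) (ω : ι → Option Bool) (i : ι) :
    |surv inc F A ω - surv inc F A (Function.update ω i none)| ≤ 12 := by
  classical
  set C := univ.filter fun z => uncInd inc z ω ≠ uncInd inc z (Function.update ω i none) with hC
  unfold surv
  rw [← Finset.sum_sub_distrib]
  calc _ ≤ ∑ k ∈ F, |∏ z ∈ A k, uncInd inc z ω -
          ∏ z ∈ A k, uncInd inc z (Function.update ω i none)| := Finset.abs_sum_le_sum_abs _ _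
    _ ≤ ∑ k ∈ F, ((A k ∩ C).card : ℝ) := Finset.sum_le_sum fun k _ =>
        abs_prod_sub_prod_le C (fun z => uncInd_eq_zero_or_one z _)
          (fun z => uncInd_eq_zero_or_one z _) fun z hz => by
            by_contra h
            exact hz (Finset.mem_filter.2 ⟨Finset.mem_univ _, h⟩)
    _ = ((F.biUnion fun k => A k ∩ C).card : ℝ) := by
        rw [Finset.card_biUnion]
        · push_cast
          rfl
        · intro a ha b hb hab
          exact (hA ha hb hab).mono Finset.inter_subset_left Finset.inter_subset_left
    _ ≤ (C.card : ℝ) := by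
        exact_mod_cast Finset.card_le_card
          (Finset.biUnion_subset.2 fun k _ => Finset.inter_subset_right)
    _ ≤ 12 := by exact_mod_cast H.card_uncInd_update_ne_le ω i

lemma card_block_le {F : Finset κ} {A : κ → Finset Z} (hF : F.card ≤ l)
    (hA : ∀ k, (A k).card ≤ 2) : (block inc F A).card ≤ 2 * l ^ 2 := by
  calc (block inc F A).card ≤ (F.biUnion A).card * l :=
        Finset.card_biUnion_le_card_mul _ _ _ fun z _ => H.star_le z
    _ ≤ (F.card * 2) * l :=
        Nat.mul_le_mul_right _ (Finset.card_biUnion_le_card_mul _ _ _ fun k _ => hA k)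
    _ ≤ (l * 2) * l := by gcongr
    _ = 2 * l ^ 2 := by ring

lemma card_wideBlock_le {F : Finset κ} {A : κ → Finset Z} (hF : F.card ≤ l)
    (hA : ∀ k, (A k).card ≤ 2) : (wideBlock inc F A).card ≤ 8 * l ^ 3 := by
  have hl := H.pos
  calc (wideBlock inc F A).card
      ≤ (block inc F A).card + ((block inc F A).biUnion (nbr inc)).card :=
        Finset.card_union_le _ _
    _ ≤ (block inc F A).card + (block inc F A).card * (3 * l) :=
        Nat.add_le_add_left (Finset.card_biUnion_le_card_mul _ _ _ fun i _ => H.card_nbr_le i) _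
    _ = (block inc F A).card * (1 + 3 * l) := by ring
    _ ≤ (2 * l ^ 2) * (4 * l) := Nat.mul_le_mul (H.card_block_le hF hA) (by omega)
    _ = 8 * l ^ 3 := by ring

/-- The number of active or blocked items of a set has bounded exponential moments. -/
lemma expect_exp_card_le (B : Finset ι) {u : ℝ} (hu0 : 0 ≤ u) (hu1 : u ≤ 1) :
    expect (actWeight inc l)
      (fun ω => Real.exp (u * (B.filter fun i => ω i ≠ none).card))
      ≤ Real.exp (2 * u * (actProb l * B.card)) := by
  have hp0 := H.actProb_pos
  let φ : ι → Option Bool → ℝ := fun i k =>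
    if i ∈ B then (if k = none then 1 else Real.exp u) else 1
  have h1 : (fun ω : ι → Option Bool => Real.exp (u * (B.filter fun i => ω i ≠ none).card))
      = fun ω => ∏ i, φ i (ω i) := by
    funext ω
    simp only [φ]
    rw [Finset.prod_ite_mem, Finset.univ_inter, Finset.prod_ite, Finset.prod_const_one, one_mul,
      Finset.prod_const, ← Real.exp_nat_mul, mul_comm]
  have h2 : ∀ i, ∑ k, actWeight inc l i k * φ i k ≤
      if i ∈ B then Real.exp (2 * u * actProb l) else 1 := by
    intro i
    by_cases hi : i ∈ B
    · simp only [φ, hi, if_true]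
      rw [Fintype.sum_option, Fintype.sum_bool]
      simp only [actWeight, if_true, reduceCtorEq, if_false]
      have h3 : Real.exp u ≤ 1 + 2 * u := by
        have := (abs_le.1 (Real.abs_exp_sub_one_sub_id_le (x := u)
          (by rw [abs_of_nonneg hu0]; exact hu1))).2
        nlinarith
      have h4 := Real.add_one_le_exp (2 * u * actProb l)
      nlinarith
    · simp only [φ, hi, if_false, mul_one]
      rw [H.isProbWeight.sum_eq_one]
  rw [h1, expect_prod]
  calc _ ≤ ∏ i, (if i ∈ B then Real.exp (2 * u * actProb l) else 1) := by
        refine Finset.prod_le_prod (fun i _ => Finset.sum_nonneg fun k _ =>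
          mul_nonneg (H.isProbWeight.nonneg i k) ?_) fun i _ => h2 i
        simp only [φ]
        split_ifs <;> positivity
    _ = _ := by
        rw [Finset.prod_ite_mem, Finset.univ_inter, Finset.prod_const, ← Real.exp_nat_mul]
        congr 1
        ring

lemma avg_exp_surv_le {F : Finset κ} {A : κ → Finset Z}
    (hA : (F : Set κ).PairwiseDisjoint A) {a : ℝ} (ha : 24 * |a| ≤ 1) (ω : ι → Option Bool) :
    avg (actWeight inc l) (block inc F A)ᶜ (fun η => Real.exp (a * (surv inc F A η -
      avg (actWeight inc l) (block inc F A)ᶜ (surv inc F A) η))) ω ≤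
      Real.exp (54 * a ^ 2 * ((block inc F A).filter fun i => ω i ≠ none).card) := by
  classical
  set w := actWeight inc l with hw
  set B := block inc F A with hB
  set f := surv inc F A with hf
  set R := B.filter fun i => ω i ≠ none with hR
  have hp0 := H.actProb_pos
  have hpl := H.mul_actProb
  let c : ι → ℝ := fun i => if ∃ j ∈ nbr inc i, j ∈ R then 12 else 0
  let f' : (ι → Option Bool) → ℝ := fun η => f (Bᶜ.piecewise η ω)
  have h1 := H.isProbWeight.avg_exp_le (o := none) (p := actProb l) (l := a)
    (fun i => le_of_eq rfl) f' c Bᶜ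
    (by
      intro i hi η
      simp only [f', c]
      have e : Bᶜ.piecewise (Function.update η i none) ω =
          Function.update (Bᶜ.piecewise η ω) i none := by
        funext j
        by_cases hj : j = i
        · subst hj
          simp [Finset.piecewise, hi]
        · by_cases hj' : j ∈ Bᶜ <;> simp [Finset.piecewise, hj, hj']
      rw [e]
      split_ifs with hex
      · exact H.abs_surv_sub_update_le hA _ _
      · rw [hf, ← surv_update_of_forall_idle (Finset.mem_compl.1 hi) (fun j hj hjB => ?_), sub_self,
          abs_zero]
        have hjB' : j ∉ Bᶜ := by simpa using hjB
        rw [Finset.piecewise_eq_of_notMem _ _ _ hjB']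
        by_contra hne
        exact hex ⟨j, hj, Finset.mem_filter.2 ⟨hjB, hne⟩⟩)
    (by
      intro i _
      simp only [c]
      split_ifs <;> linarith) ω
  have h2 : ∀ η, avg w Bᶜ f' η = avg w Bᶜ f ω := by
    intro η
    simp only [avg, f']
    congr 1
    funext ζ
    congr 1
    funext j
    by_cases hj : j ∈ Bᶜ <;> simp [Finset.piecewise, hj]
  have h3 : ∀ η, avg w Bᶜ f (Bᶜ.piecewise η ω) = avg w Bᶜ f ω := fun η =>
    avg_congr fun j hj => by simp [Finset.piecewise, hj]
  have h4 : avg w Bᶜ (fun η => Real.exp (a * (f η - avg w Bᶜ f η))) ω =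
      avg w Bᶜ (fun η => Real.exp (a * (f' η - avg w Bᶜ f' η))) ω := by
    simp only [avg]
    congr 1
    funext η
    have e1 := h3 η
    have e2 := h2 (Bᶜ.piecewise η ω)
    simp only [avg] at e1 e2
    rw [e1, e2]
    congr 3
    simp only [f']
    congr 1
    funext j
    by_cases hj : j ∈ Bᶜ <;> simp [Finset.piecewise, hj]
  rw [h4]
  refine h1.trans (Real.exp_le_exp.2 ?_)
  have h5 : ∑ i ∈ Bᶜ, c i ^ 2 ≤ 144 * (3 * l * R.card) := by
    calc ∑ i ∈ Bᶜ, c i ^ 2 ≤ ∑ i ∈ univ, c i ^ 2 :=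
          Finset.sum_le_sum_of_subset_of_nonneg (Finset.subset_univ _) fun i _ _ => sq_nonneg _
      _ = ∑ i ∈ univ.filter (fun i => ∃ j ∈ nbr inc i, j ∈ R), (144 : ℝ) := by
          rw [Finset.sum_filter]
          refine Finset.sum_congr rfl fun i _ => ?_
          simp only [c]
          split_ifs <;> norm_num
      _ = 144 * (univ.filter (fun i => ∃ j ∈ nbr inc i, j ∈ R)).card := by
          rw [Finset.sum_const, nsmul_eq_mul, mul_comm]
      _ ≤ 144 * ((R.biUnion (nbr inc)).card : ℝ) := by
          refine mul_le_mul_of_nonneg_left ?_ (by norm_num)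
          exact_mod_cast Finset.card_le_card fun i hi => by
            obtain ⟨j, hj, hjR⟩ := (Finset.mem_filter.1 hi).2
            exact Finset.mem_biUnion.2 ⟨j, hjR, mem_nbr_comm.1 hj⟩
      _ ≤ 144 * (3 * l * R.card) := by
          refine mul_le_mul_of_nonneg_left ?_ (by norm_num)
          have := Finset.card_biUnion_le_card_mul R (nbr inc) (3 * l)
            fun i _ => H.card_nbr_le i
          rw [mul_comm]
          exact_mod_cast this
  calc a ^ 2 * (actProb l * ∑ i ∈ Bᶜ, c i ^ 2)
      ≤ a ^ 2 * (actProb l * (144 * (3 * l * R.card))) := by gcongr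
    _ = a ^ 2 * (432 * (l * actProb l) * R.card) := by ring
    _ = 54 * a ^ 2 * R.card := by rw [hpl]; ring

/-- Concentration of the number of surviving sets. -/
theorem prob_surv_deviation_le {F : Finset κ} {A : κ → Finset Z}
    (hA : (F : Set κ).PairwiseDisjoint A) (hF : F.card ≤ l) (hA2 : ∀ k, (A k).card ≤ 2)
    {a τ : ℝ} (ha0 : 0 ≤ a) (ha : 24 * a ≤ 1) :
    prob (actWeight inc l) (fun ω => 2 * τ ≤
      |surv inc F A ω - expect (actWeight inc l) (surv inc F A)|)
      ≤ 4 * Real.exp (36 * a ^ 2 * l - a * τ) := by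
  classical
  set w := actWeight inc l with hw
  set B := block inc F A with hB
  set f := surv inc F A with hf
  set g := avg w Bᶜ f with hg
  have hp0 := H.actProb_pos
  have hpl := H.mul_actProb
  have hBc : ((B.card : ℕ) : ℝ) ≤ 2 * l ^ 2 := by exact_mod_cast H.card_block_le hF hA2
  have hBp : actProb l * B.card ≤ l / 4 := by
    calc actProb l * B.card ≤ actProb l * (2 * l ^ 2) := by gcongr
      _ = 2 * (l * actProb l) * l := by ring
      _ = l / 4 := by rw [hpl]; ring
  have hl0 : (0 : ℝ) ≤ l := Nat.cast_nonneg l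
  have h1 : ∀ b : ℝ, b ^ 2 = a ^ 2 → |b| = a → expect w (fun ω => Real.exp (b * (f ω - g ω))) ≤
      Real.exp (36 * a ^ 2 * l) := by
    intro b hb hba
    rw [← H.isProbWeight.expect_avg Bᶜ]
    refine (H.isProbWeight.expect_mono fun ω =>
      H.avg_exp_surv_le hA (by rw [hba]; exact ha) ω).trans ?_
    refine (H.expect_exp_card_le _ (by positivity) (by rw [hb]; nlinarith)).trans ?_
    rw [Real.exp_le_exp, hb]
    calc 2 * (54 * a ^ 2) * (actProb l * B.card) ≤ 2 * (54 * a ^ 2) * (l / 4) := by gcongr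
      _ = 27 * (a ^ 2 * l) := by ring
      _ ≤ 36 * a ^ 2 * l := by
        have : 0 ≤ a ^ 2 * l := by positivity
        linarith
  have hgm : ∀ ω, avg w B g ω = expect w f := by
    intro ω
    rw [hg, H.isProbWeight.avg_avg, Finset.union_compl, avg]
    simp only [Finset.piecewise_univ]
    rfl
  have h2 : ∀ b : ℝ, b ^ 2 = a ^ 2 → |b| = a →
      expect w (fun ω => Real.exp (b * (g ω - expect w f))) ≤ Real.exp (36 * a ^ 2 * l) := by
    intro b hb hba
    rw [← H.isProbWeight.expect_avg B]
    have h3 : ∀ ω, avg w B (fun ω => Real.exp (b * (g ω - expect w f))) ω ≤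
        Real.exp (b ^ 2 * (actProb l * ∑ i ∈ B, (12 : ℝ) ^ 2)) := by
      intro ω
      have := H.isProbWeight.avg_exp_le (o := none) (p := actProb l) (l := b)
        (fun i => le_of_eq rfl) g (fun _ => 12) B ?_ ?_ ω
      · simpa only [← hw, hgm] using this
      · intro i hi η
        have e : g η - g (Function.update η i none) = expect w fun ζ =>
            f (Bᶜ.piecewise ζ η) - f (Function.update (Bᶜ.piecewise ζ η) i none) := by
          rw [expect_sub, hg]
          simp only [avg]
          congr 3
          funext ζ
          rw [Finset.update_piecewise_of_notMem Bᶜ ζ η (by simpa using hi)]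
        rw [e, abs_le]
        have hb := fun ζ => abs_le.1 (H.abs_surv_sub_update_le hA (Bᶜ.piecewise ζ η) i)
        constructor
        · calc -12 = expect w (fun _ => (-12 : ℝ)) := (H.isProbWeight.expect_const _).symm
            _ ≤ _ := H.isProbWeight.expect_mono fun ζ => (hb ζ).1
        · calc _ ≤ expect w (fun _ => (12 : ℝ)) := H.isProbWeight.expect_mono fun ζ => (hb ζ).2
            _ = 12 := H.isProbWeight.expect_const _
      · intro i _
        rw [hba]
        linarith
    refine (H.isProbWeight.expect_mono h3).trans ?_
    rw [H.isProbWeight.expect_const, Real.exp_le_exp, hb, Finset.sum_const, nsmul_eq_mul]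
    calc a ^ 2 * (actProb l * (B.card * 12 ^ 2)) = 144 * a ^ 2 * (actProb l * B.card) := by ring
      _ ≤ 144 * a ^ 2 * (l / 4) := by gcongr
      _ = 36 * a ^ 2 * l := by ring
  have h4 : prob w (fun ω => 2 * τ ≤ |f ω - expect w f|) ≤ expect w fun ω =>
      ((Real.exp (a * (f ω - g ω)) + Real.exp (-a * (f ω - g ω))) +
        (Real.exp (a * (g ω - expect w f)) + Real.exp (-a * (g ω - expect w f)))) *
        Real.exp (-(a * τ)) := by
    refine H.isProbWeight.expect_mono fun ω => ?_
    split_ifs with h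
    · have hone : ∀ y, a * τ ≤ y → 1 ≤ Real.exp y * Real.exp (-(a * τ)) := by
        intro y hy
        rw [← Real.exp_add]
        exact Real.one_le_exp (by linarith)
      have p1 := mul_pos (Real.exp_pos (a * (f ω - g ω))) (Real.exp_pos (-(a * τ)))
      have p2 := mul_pos (Real.exp_pos (-a * (f ω - g ω))) (Real.exp_pos (-(a * τ)))
      have p3 := mul_pos (Real.exp_pos (a * (g ω - expect w f))) (Real.exp_pos (-(a * τ)))
      have p4 := mul_pos (Real.exp_pos (-a * (g ω - expect w f))) (Real.exp_pos (-(a * τ)))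
      rcases le_abs'.1 h with h | h
      · by_cases hc : f ω - g ω ≤ -τ
        · have := hone (-a * (f ω - g ω)) (by nlinarith)
          linarith
        · have := hone (-a * (g ω - expect w f)) (by nlinarith)
          linarith
      · by_cases hc : τ ≤ f ω - g ω
        · have := hone (a * (f ω - g ω)) (by nlinarith)
          linarith
        · have := hone (a * (g ω - expect w f)) (by nlinarith)
          linarith
    · positivity
  refine h4.trans ?_
  rw [expect_mul_const, expect_add, expect_add, expect_add]
  have ha' : |(-a)| = a := by rw [abs_neg, abs_of_nonneg ha0]
  have b1 := h1 a rfl (abs_of_nonneg ha0)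
  have b2 := h1 (-a) (by ring) ha'
  have b3 := h2 a rfl (abs_of_nonneg ha0)
  have b4 := h2 (-a) (by ring) ha'
  calc _ ≤ (4 * Real.exp (36 * a ^ 2 * l)) * Real.exp (-(a * τ)) := by
        refine mul_le_mul_of_nonneg_right ?_ (Real.exp_pos _).le
        linarith
    _ = _ := by
        rw [mul_assoc, ← Real.exp_add]
        rfl

end IsBoundedLinear
end Survivors

section Selection

variable {ι Z κ J : Type*} [Fintype ι] [DecidableEq ι] [Fintype Z] [DecidableEq Z]
  [Fintype J] [DecidableEq J] {inc : ι → Finset Z} {l : ℕ}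

/-- If every vertex lies in few of the test families, some outcome of the random selection
makes all the numbers of surviving sets close to their expectations. -/
theorem IsBoundedLinear.exists_surv_close (H : IsBoundedLinear inc l) (F : J → Finset κ)
    (A : J → κ → Finset Z) (hA : ∀ j, (F j : Set κ).PairwiseDisjoint (A j))
    (hF : ∀ j, (F j).card ≤ l) (hA2 : ∀ j k, (A j k).card ≤ 2)
    (hJ : ∀ z, (univ.filter fun j => z ∈ (F j).biUnion (A j)).card ≤ 5 * l)
    {a τ : ℝ} (ha0 : 0 ≤ a) (ha : 24 * a ≤ 1)
    (hexp : 7680 * (l : ℝ) ^ 5 * Real.exp (36 * a ^ 2 * l - a * τ) ≤ 1) :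
    ∃ ω, ∀ j, |surv inc (F j) (A j) ω - expect (actWeight inc l) (surv inc (F j) (A j))| < 2 * τ := by
  have hl : 0 < l := H.pos
  have hblock : ∀ i, (univ.filter fun j => i ∈ block inc (F j) (A j)).card ≤ 15 * l := by
    intro i
    calc _ ≤ ((inc i).biUnion fun z => univ.filter fun j => z ∈ (F j).biUnion (A j)).card := by
          refine Finset.card_le_card fun j hj => ?_
          obtain ⟨z, hz, hz'⟩ := Finset.mem_biUnion.1 (Finset.mem_filter.1 hj).2
          exact Finset.mem_biUnion.2 ⟨z, mem_star.1 hz', Finset.mem_filter.2 ⟨Finset.mem_univ _, hz⟩⟩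
      _ ≤ (inc i).card * (5 * l) := Finset.card_biUnion_le_card_mul _ _ _ fun z _ => hJ z
      _ ≤ 3 * (5 * l) := Nat.mul_le_mul_right _ (H.card_le i)
      _ = 15 * l := by ring
  have hwide : ∀ i, (univ.filter fun j => i ∈ wideBlock inc (F j) (A j)).card ≤ 60 * l ^ 2 := by
    intro i
    calc _ ≤ ((insert i (nbr inc i)).biUnion fun i' =>
          univ.filter fun j => i' ∈ block inc (F j) (A j)).card := by
          refine Finset.card_le_card fun j hj => ?_
          rcases Finset.mem_union.1 (Finset.mem_filter.1 hj).2 with h | h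
          · exact Finset.mem_biUnion.2 ⟨i, Finset.mem_insert_self _ _,
              Finset.mem_filter.2 ⟨Finset.mem_univ _, h⟩⟩
          · obtain ⟨i', hi', hn⟩ := Finset.mem_biUnion.1 h
            exact Finset.mem_biUnion.2 ⟨i', Finset.mem_insert_of_mem (mem_nbr_comm.1 hn),
              Finset.mem_filter.2 ⟨Finset.mem_univ _, hi'⟩⟩
      _ ≤ (insert i (nbr inc i)).card * (15 * l) :=
          Finset.card_biUnion_le_card_mul _ _ _ fun i' _ => hblock i'
      _ ≤ (4 * l) * (15 * l) := by
          refine Nat.mul_le_mul_right _ ?_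
          have h1 := Finset.card_insert_le i (nbr inc i)
          have h2 := H.card_nbr_le i
          omega
      _ = 60 * l ^ 2 := by ring
  set E := Real.exp (36 * a ^ 2 * l - a * τ) with hE
  have hE0 : 0 < E := Real.exp_pos _
  have hl1 : (1 : ℝ) ≤ (l : ℝ) ^ 5 := one_le_pow₀ (by exact_mod_cast hl)
  obtain ⟨ω, hω⟩ := exists_forall_not_of_symmetric H.isProbWeight
    (fun j ω => 2 * τ ≤ |surv inc (F j) (A j) ω -
      expect (actWeight inc l) (surv inc (F j) (A j))|)
    (fun j => wideBlock inc (F j) (A j))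
    (fun j ω ω' h => by
      simp only [surv_dependsOn (F j) (A j) h])
    (4 * E) (by nlinarith) (480 * l ^ 5)
    (fun j => H.prob_surv_deviation_le (hA j) (hF j) (hA2 j) ha0 ha)
    (fun j => by
      have : (univ.filter (fun k => k ≠ j ∧ ¬ Disjoint (wideBlock inc (F j) (A j))
          (wideBlock inc (F k) (A k)))).card ≤ 480 * l ^ 5 := by
        calc _ ≤ ((wideBlock inc (F j) (A j)).biUnion fun i =>
              univ.filter fun k => i ∈ wideBlock inc (F k) (A k)).card := by
              refine Finset.card_le_card fun k hk => ?_
              obtain ⟨i, hi, hi'⟩ := Finset.not_disjoint_iff.1 (Finset.mem_filter.1 hk).2.2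
              exact Finset.mem_biUnion.2 ⟨i, hi, Finset.mem_filter.2 ⟨Finset.mem_univ _, hi'⟩⟩
          _ ≤ (wideBlock inc (F j) (A j)).card * (60 * l ^ 2) :=
              Finset.card_biUnion_le_card_mul _ _ _ fun i _ => hwide i
          _ ≤ (8 * l ^ 3) * (60 * l ^ 2) :=
              Nat.mul_le_mul_right _ (H.card_wideBlock_le (hF j) (hA2 j))
          _ = 480 * l ^ 5 := by ring
      exact_mod_cast this)
    (by linarith)
  exact ⟨ω, fun j => not_le.1 (hω j)⟩

end Selection

section ColourStep

variable {V β : Type*} [Fintype V] [DecidableEq V] [Fintype β] [DecidableEq β]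

/-- The number of edges of `U` at `v` whose list contains `α`. -/
def cdeg (U : Finset (Sym2 V)) (L : Sym2 V → Finset β) (v : V) (α : β) : ℕ :=
  (U.filter fun e => v ∈ e ∧ α ∈ L e).card

/-- The items are pairs of an edge and a colour, together with dummy items which make the
degrees of all pairs of a vertex and a colour equal to `t`. -/
def itemInc (U : Finset (Sym2 V)) (L : Sym2 V → Finset β) (t : ℕ) :
    (Sym2 V × β) ⊕ (V × β × Fin t) → Finset (Sym2 V ⊕ V × β)
  | Sum.inl x => if x.1 ∈ U ∧ x.2 ∈ L x.1 then
      insert (Sum.inl x.1) (x.1.toFinset.image fun v => Sum.inr (v, x.2)) else ∅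
  | Sum.inr y => if (y.2.2 : ℕ) < t - cdeg U L y.1 y.2.1 then {Sum.inr (y.1, y.2.1)} else ∅

variable {U : Finset (Sym2 V)} {L : Sym2 V → Finset β} {l t : ℕ}

lemma inl_mem_itemInc_inl {e f : Sym2 V} {α : β} :
    (Sum.inl f : Sym2 V ⊕ V × β) ∈ itemInc U L t (Sum.inl (e, α)) ↔
      (e ∈ U ∧ α ∈ L e) ∧ f = e := by
  simp only [itemInc]
  split_ifs with h <;> simp [h]

lemma inr_mem_itemInc_inl {e : Sym2 V} {v : V} {α α' : β} :
    (Sum.inr (v, α') : Sym2 V ⊕ V × β) ∈ itemInc U L t (Sum.inl (e, α)) ↔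
      (e ∈ U ∧ α ∈ L e) ∧ v ∈ e ∧ α' = α := by
  simp only [itemInc]
  split_ifs with h
  · simp [h, eq_comm]
  · simp [h]

lemma inl_notMem_itemInc_inr {f : Sym2 V} {y : V × β × Fin t} :
    (Sum.inl f : Sym2 V ⊕ V × β) ∉ itemInc U L t (Sum.inr y) := by
  simp only [itemInc]
  split_ifs with h <;> simp

lemma inr_mem_itemInc_inr {x : V × β} {y : V × β × Fin t} :
    (Sum.inr x : Sym2 V ⊕ V × β) ∈ itemInc U L t (Sum.inr y) ↔
      (y.2.2 : ℕ) < t - cdeg U L y.1 y.2.1 ∧ x = (y.1, y.2.1) := by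
  simp only [itemInc]
  split_ifs with h <;> simp [h]

lemma card_sym2_toFinset_le (e : Sym2 V) : e.toFinset.card ≤ 2 := by
  rw [Sym2.card_toFinset]
  split_ifs <;> norm_num

lemma card_itemInc_le (i : (Sym2 V × β) ⊕ (V × β × Fin t)) : (itemInc U L t i).card ≤ 3 := by
  rcases i with x | y
  · simp only [itemInc]
    split_ifs
    · refine (Finset.card_insert_le _ _).trans ?_
      have h1 := Finset.card_image_le (s := x.1.toFinset)
        (f := fun v => (Sum.inr (v, x.2) : Sym2 V ⊕ V × β))
      have h2 := card_sym2_toFinset_le x.1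
      omega
    · simp
  · simp only [itemInc]
    split_ifs <;> simp

lemma card_star_inl {e : Sym2 V} (he : e ∈ U) :
    (star (itemInc U L t) (Sum.inl e)).card = (L e).card := by
  rw [show star (itemInc U L t) (Sum.inl e) = (L e).image fun α => Sum.inl (e, α) by
    ext i
    rcases i with ⟨f, α⟩ | y
    · simp only [mem_star, inl_mem_itemInc_inl, Finset.mem_image, Sum.inl.injEq, Prod.mk.injEq,
        exists_eq_right_right]
      constructor
      · rintro ⟨⟨-, h⟩, rfl⟩
        exact ⟨h, rfl⟩
      · rintro ⟨h, rfl⟩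
        exact ⟨⟨he, h⟩, rfl⟩
    · simp [mem_star, inl_notMem_itemInc_inr]]
  refine Finset.card_image_of_injective _ fun α α' h => ?_
  simpa using h

lemma card_star_inl_le (hL : ∀ e ∈ U, (L e).card = l) (e : Sym2 V) :
    (star (itemInc U L t) (Sum.inl e)).card ≤ l := by
  by_cases he : e ∈ U
  · rw [card_star_inl he, hL e he]
  · rw [show star (itemInc U L t) (Sum.inl e) = ∅ from Finset.eq_empty_of_forall_notMem fun i => by
      rcases i with ⟨f, α⟩ | y
      · rw [mem_star, inl_mem_itemInc_inl]
        rintro ⟨⟨h, -⟩, rfl⟩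
        exact he h
      · rw [mem_star]
        exact inl_notMem_itemInc_inr]
    simp

lemma card_star_inr (hc : ∀ v α, cdeg U L v α ≤ t) (v : V) (α : β) :
    (star (itemInc U L t) (Sum.inr (v, α))).card = t := by
  rw [show star (itemInc U L t) (Sum.inr (v, α)) =
      (U.filter fun e => v ∈ e ∧ α ∈ L e).image (fun e => Sum.inl (e, α)) ∪
        (univ.filter fun k : Fin t => (k : ℕ) < t - cdeg U L v α).image
          (fun k => Sum.inr (v, α, k)) by
    ext i
    rcases i with ⟨f, α'⟩ | ⟨v', α', k⟩
    · simp only [mem_star, inr_mem_itemInc_inl, Finset.mem_union, Finset.mem_image,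
        Finset.mem_filter, Sum.inl.injEq, Prod.mk.injEq, reduceCtorEq, and_false, exists_false,
        or_false]
      constructor
      · rintro ⟨⟨h1, h2⟩, h3, rfl⟩
        exact ⟨f, ⟨h1, h3, h2⟩, rfl, rfl⟩
      · rintro ⟨e, ⟨h1, h3, h2⟩, rfl, rfl⟩
        exact ⟨⟨h1, h2⟩, h3, rfl⟩
    · simp only [mem_star, inr_mem_itemInc_inr, Finset.mem_union, Finset.mem_image,
        Finset.mem_filter, Sum.inr.injEq, Prod.mk.injEq, reduceCtorEq, and_false, exists_false,
        false_or, Finset.mem_univ, true_and]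
      constructor
      · rintro ⟨h1, rfl, rfl⟩
        exact ⟨k, h1, rfl, rfl, rfl⟩
      · rintro ⟨k', h1, rfl, rfl, rfl⟩
        exact ⟨h1, rfl, rfl⟩]
  rw [Finset.card_union_of_disjoint, Finset.card_image_of_injective, Finset.card_image_of_injective,
    Fin.card_filter_val_lt]
  · change cdeg U L v α + _ = t
    have := hc v α
    omega
  · intro k k' h
    simpa using h
  · intro e e' h
    simpa using h
  · rw [Finset.disjoint_left]
    intro i hi hi'
    obtain ⟨e, -, rfl⟩ := Finset.mem_image.1 hi
    obtain ⟨k, -, h⟩ := Finset.mem_image.1 hi'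
    cases h

lemma eq_of_mem_itemInc {i j : (Sym2 V × β) ⊕ (V × β × Fin t)} {z z' : Sym2 V ⊕ V × β}
    (hz : z ≠ z') (hi : z ∈ itemInc U L t i) (hi' : z' ∈ itemInc U L t i)
    (hj : z ∈ itemInc U L t j) (hj' : z' ∈ itemInc U L t j) : i = j := by
  rcases i with ⟨e, α⟩ | y
  · rcases j with ⟨f, α'⟩ | y'
    · rcases z with g | ⟨v, b⟩
      · rw [inl_mem_itemInc_inl] at hi hj
        have hef : e = f := hi.2.symm.trans hj.2
        rcases z' with g' | ⟨v', b'⟩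
        · rw [inl_mem_itemInc_inl] at hi'
          exact absurd (by rw [hi.2, hi'.2]) hz
        · rw [inr_mem_itemInc_inl] at hi' hj'
          rw [hef, hi'.2.2.symm.trans hj'.2.2]
      · rw [inr_mem_itemInc_inl] at hi hj
        have hα : α = α' := hi.2.2.symm.trans hj.2.2
        rcases z' with g' | ⟨v', b'⟩
        · rw [inl_mem_itemInc_inl] at hi' hj'
          rw [hα, hi'.2.symm.trans hj'.2]
        · rw [inr_mem_itemInc_inl] at hi' hj'
          have hv : v ≠ v' := by
            rintro rfl
            exact hz (by rw [hi.2.2, hi'.2.2])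
          rw [hα, ((Sym2.mem_and_mem_iff hv).1 ⟨hi.2.1, hi'.2.1⟩).trans
            ((Sym2.mem_and_mem_iff hv).1 ⟨hj.2.1, hj'.2.1⟩).symm]
    · exfalso
      rcases z with g | x
      · exact inl_notMem_itemInc_inr hj
      · rcases z' with g' | x'
        · exact inl_notMem_itemInc_inr hj'
        · exact hz (by rw [(inr_mem_itemInc_inr.1 hj).2, (inr_mem_itemInc_inr.1 hj').2])
  · exfalso
    rcases z with g | x
    · exact inl_notMem_itemInc_inr hi
    · rcases z' with g' | x'
      · exact inl_notMem_itemInc_inr hi'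
      · exact hz (by rw [(inr_mem_itemInc_inr.1 hi).2, (inr_mem_itemInc_inr.1 hi').2])

lemma isBoundedLinear_itemInc (hl : 0 < l) (htl : t ≤ l) (hL : ∀ e ∈ U, (L e).card = l)
    (hc : ∀ v α, cdeg U L v α ≤ t) : IsBoundedLinear (itemInc U L t) l where
  pos := hl
  card_le := card_itemInc_le
  linear i j hij := by
    refine Finset.card_le_one.2 fun z hz z' hz' => ?_
    by_contra hne
    rw [Finset.mem_inter] at hz hz'
    exact hij (eq_of_mem_itemInc hne hz.1 hz'.1 hz.2 hz'.2)
  star_le z := by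
    rcases z with e | ⟨v, α⟩
    · exact card_star_inl_le hL e
    · rw [card_star_inr hc]
      exact htl

end ColourStep

section SurvCard

variable {ι Z κ : Type*} [Fintype ι] [DecidableEq ι] [Fintype Z] [DecidableEq Z]
  {inc : ι → Finset Z}

open scoped Classical in
lemma surv_eq_card (F : Finset κ) (A : κ → Finset Z) (ω : ι → Option Bool) :
    surv inc F A ω = (F.filter fun k => ∀ z ∈ A k, ¬ Cov inc ω z).card := by
  rw [Finset.card_filter]
  push_cast
  refine Finset.sum_congr rfl fun k _ => ?_
  split_ifs with h
  · exact Finset.prod_eq_one fun z hz => by simp [uncInd, h z hz]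
  · push Not at h
    obtain ⟨z, hz, hc⟩ := h
    exact Finset.prod_eq_zero hz (by simp [uncInd, hc])

lemma expect_surv (w : ι → Option Bool → ℝ) (F : Finset κ) (A : κ → Finset Z) :
    expect w (surv inc F A) = ∑ k ∈ F, expect w fun ω => ∏ z ∈ A k, uncInd inc z ω :=
  expect_sum _ _

end SurvCard

section ColourStep

variable {V β : Type*} [Fintype V] [DecidableEq V] [Fintype β] [DecidableEq β]
variable {U : Finset (Sym2 V)} {L : Sym2 V → Finset β} {l t : ℕ}

/-- The test families: one for each vertex of the hypergraph, and one for each vertex of the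
graph. -/
def testIdx (U : Finset (Sym2 V)) (L : Sym2 V → Finset β) (t : ℕ) (M : V → Finset (Sym2 V)) :
    (Sym2 V ⊕ V × β) ⊕ V → Finset (((Sym2 V × β) ⊕ (V × β × Fin t)) ⊕ (Sym2 V ⊕ V × β))
  | Sum.inl z => ((star (itemInc U L t) z).filter fun i => i.isLeft).map Function.Embedding.inl
  | Sum.inr v => (M v).map (Function.Embedding.inl.trans Function.Embedding.inr)

/-- The sets of the test families. -/
def testSet (U : Finset (Sym2 V)) (L : Sym2 V → Finset β) (t : ℕ) :
    (Sym2 V ⊕ V × β) ⊕ V → ((Sym2 V × β) ⊕ (V × β × Fin t)) ⊕ (Sym2 V ⊕ V × β) →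
      Finset (Sym2 V ⊕ V × β)
  | Sum.inl z, Sum.inl i => if z ∈ itemInc U L t i then (itemInc U L t i).erase z else ∅
  | Sum.inl _, Sum.inr _ => ∅
  | Sum.inr _, Sum.inl _ => ∅
  | Sum.inr _, Sum.inr z => {z}

variable {M : V → Finset (Sym2 V)}

lemma card_testSet_le (j : (Sym2 V ⊕ V × β) ⊕ V)
    (k : ((Sym2 V × β) ⊕ (V × β × Fin t)) ⊕ (Sym2 V ⊕ V × β)) :
    (testSet U L t j k).card ≤ 2 := by
  rcases j with z | v <;> rcases k with i | y
  · simp only [testSet]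
    split_ifs with h
    · rw [Finset.card_erase_of_mem h]
      have := card_itemInc_le (U := U) (L := L) i
      omega
    · simp
  all_goals simp [testSet]

lemma pairwiseDisjoint_testSet (j : (Sym2 V ⊕ V × β) ⊕ V) :
    (testIdx U L t M j : Set _).PairwiseDisjoint (testSet U L t j) := by
  intro k hk k' hk' hkk'
  change Disjoint (testSet U L t j k) (testSet U L t j k')
  rw [Finset.disjoint_left]
  intro z' hz hz'
  rcases j with z | v
  · rcases k with i | y
    · rcases k' with i' | y'
      · simp only [testSet] at hz hz'
        split_ifs at hz with h
        · split_ifs at hz' with h'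
          · rw [Finset.mem_erase] at hz hz'
            exact hkk' (congrArg _ (eq_of_mem_itemInc hz.1 hz.2 h hz'.2 h'))
          · simp at hz'
        · simp at hz
      · simp [testSet] at hz'
    · simp [testSet] at hz
  · rcases k with i | y
    · simp [testSet] at hz
    · rcases k' with i' | y'
      · simp [testSet] at hz'
      · simp only [testSet, Finset.mem_singleton] at hz hz'
        exact hkk' (by rw [← hz, ← hz'])

lemma card_testIdx_le (H : IsBoundedLinear (itemInc U L t) l) (hM : ∀ v, (M v).card ≤ l)
    (j : (Sym2 V ⊕ V × β) ⊕ V) : (testIdx U L t M j).card ≤ l := by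
  rcases j with z | v
  · simp only [testIdx, Finset.card_map]
    exact (Finset.card_le_card (Finset.filter_subset _ _)).trans (H.star_le z)
  · simp only [testIdx, Finset.card_map]
    exact hM v

lemma card_filter_mem_testSet_le (H : IsBoundedLinear (itemInc U L t) l)
    (hM : ∀ v, ∀ e ∈ M v, v ∈ e) (z : Sym2 V ⊕ V × β) :
    (univ.filter fun j => z ∈ (testIdx U L t M j).biUnion (testSet U L t j)).card ≤ 5 * l := by
  have hl := H.pos
  let T1 : Finset ((Sym2 V ⊕ V × β) ⊕ V) :=
    ((star (itemInc U L t) z).biUnion (itemInc U L t)).image Sum.inl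
  let T2 : Finset ((Sym2 V ⊕ V × β) ⊕ V) :=
    (Sum.elim Sym2.toFinset (fun _ => ∅) z).image Sum.inr
  have h1 : T1.card ≤ 3 * l := by
    refine Finset.card_image_le.trans ((Finset.card_biUnion_le_card_mul _ _ 3
      fun i _ => H.card_le i).trans ?_)
    have := H.star_le z
    omega
  have h2 : T2.card ≤ 2 := by
    refine Finset.card_image_le.trans ?_
    rcases z with e | x
    · exact card_sym2_toFinset_le e
    · simp
  calc _ ≤ (T1 ∪ T2).card := by
        refine Finset.card_le_card fun j hj => ?_
        obtain ⟨k, hk, hz⟩ := Finset.mem_biUnion.1 (Finset.mem_filter.1 hj).2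
        rcases j with z' | v
        · refine Finset.mem_union_left _ (Finset.mem_image_of_mem _ ?_)
          rcases k with i | y
          · simp only [testSet] at hz
            split_ifs at hz with h
            · exact Finset.mem_biUnion.2 ⟨i, mem_star.2 (Finset.mem_of_mem_erase hz), h⟩
            · simp at hz
          · simp [testSet] at hz
        · refine Finset.mem_union_right _ (Finset.mem_image_of_mem _ ?_)
          rcases k with i | y
          · simp [testSet] at hz
          · simp only [testSet, Finset.mem_singleton] at hz
            simp only [testIdx, Finset.mem_map] at hk
            obtain ⟨e, he, hey⟩ := hk
            have : Sum.inl e = y := Sum.inr_injective hey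
            rw [hz, ← this]
            exact Sym2.mem_toFinset.2 (hM v e he)
    _ ≤ T1.card + T2.card := Finset.card_union_le _ _
    _ ≤ 5 * l := by omega

lemma itemInc_inl {u v : V} {α : β} (he : s(u, v) ∈ U) (hα : α ∈ L s(u, v)) :
    itemInc U L t (Sum.inl (s(u, v), α)) =
      {Sum.inl s(u, v), Sum.inr (u, α), Sum.inr (v, α)} := by
  simp only [itemInc, he, hα, and_self, if_true]
  ext z
  rcases z with f | ⟨w, b⟩
  · simp
  · simp [eq_comm]

lemma testSet_inl_inl {u v : V} {α : β} (he : s(u, v) ∈ U) (hα : α ∈ L s(u, v)) :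
    testSet U L t (Sum.inl (Sum.inl s(u, v))) (Sum.inl (Sum.inl (s(u, v), α))) =
      {Sum.inr (u, α), Sum.inr (v, α)} := by
  simp only [testSet, itemInc_inl he hα]
  rw [if_pos (Finset.mem_insert_self _ _), Finset.erase_insert]
  simp

lemma testSet_inl_inr {u v : V} {α : β} (huv : u ≠ v) (he : s(u, v) ∈ U) (hα : α ∈ L s(u, v)) :
    testSet U L t (Sum.inl (Sum.inr (u, α))) (Sum.inl (Sum.inl (s(u, v), α))) =
      {Sum.inl s(u, v), Sum.inr (v, α)} := by
  simp only [testSet, itemInc_inl he hα]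
  rw [if_pos (by simp)]
  ext z
  rcases z with f | ⟨w, b⟩
  · simp
  · simp only [Finset.mem_erase, Finset.mem_insert, Finset.mem_singleton, reduceCtorEq, false_or,
      Sum.inr.injEq, Prod.mk.injEq, ne_eq]
    constructor
    · rintro ⟨h1, h2 | h2⟩
      · exact absurd h2 h1
      · exact h2
    · rintro ⟨rfl, rfl⟩
      exact ⟨fun h => huv h.1.symm, Or.inr ⟨rfl, rfl⟩⟩

lemma expect_surv_edge (H : IsBoundedLinear (itemInc U L t) l) (hU : ∀ e ∈ U, ¬ e.IsDiag)
    (hL : ∀ e ∈ U, (L e).card = l) (hc : ∀ v α, cdeg U L v α ≤ t) {e : Sym2 V} (he : e ∈ U) :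
    l * (1 - t * succProb l) ^ 2 - 1 / 4 ≤ expect (actWeight (itemInc U L t) l)
      (surv (itemInc U L t) (testIdx U L t M (Sum.inl (Sum.inl e)))
        (testSet U L t (Sum.inl (Sum.inl e)))) := by
  rw [expect_surv]
  simp only [testIdx, Finset.sum_map, Function.Embedding.inl_apply]
  have hleft : (star (itemInc U L t) (Sum.inl e)).filter (fun i => i.isLeft) =
      star (itemInc U L t) (Sum.inl e) := by
    refine Finset.filter_true_of_mem fun i hi => ?_
    rcases i with x | y
    · rfl
    · exact absurd (mem_star.1 hi) inl_notMem_itemInc_inr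
  rw [hleft]
  have h1 : ∀ i ∈ star (itemInc U L t) (Sum.inl e),
      (1 - t * succProb l) ^ 2 - 2 * actProb l ≤ expect (actWeight (itemInc U L t) l) fun ω =>
        ∏ z ∈ testSet U L t (Sum.inl (Sum.inl e)) (Sum.inl i), uncInd (itemInc U L t) z ω := by
    intro i hi
    rcases i with ⟨f, α⟩ | y
    · rw [mem_star, inl_mem_itemInc_inl] at hi
      obtain ⟨⟨-, hα⟩, rfl⟩ := hi
      induction e using Sym2.ind with
      | _ u v =>
      have huv : u ≠ v := fun h => hU _ he (Sym2.mk_isDiag_iff.2 h)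
      have hne : (Sum.inr (u, α) : Sym2 V ⊕ V × β) ≠ Sum.inr (v, α) := by simpa using huv
      simp only [testSet_inl_inl he hα, Finset.prod_pair hne]
      have := (abs_le.1 (H.expect_uncInd_mul hne)).1
      rw [card_star_inr hc, card_star_inr hc] at this
      linarith
    · exact absurd (mem_star.1 hi) inl_notMem_itemInc_inr
  have h2 := Finset.card_nsmul_le_sum _ _ _ h1
  rw [card_star_inl he, hL e he, nsmul_eq_mul] at h2
  have h3 := H.mul_actProb
  linarith

lemma expect_surv_colour (H : IsBoundedLinear (itemInc U L t) l) (hU : ∀ e ∈ U, ¬ e.IsDiag)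
    (htl : t ≤ l) (hL : ∀ e ∈ U, (L e).card = l) (hc : ∀ v α, cdeg U L v α ≤ t) (u : V) (α : β) :
    expect (actWeight (itemInc U L t) l)
      (surv (itemInc U L t) (testIdx U L t M (Sum.inl (Sum.inr (u, α))))
        (testSet U L t (Sum.inl (Sum.inr (u, α))))) ≤
      t * ((1 - l * succProb l) * (1 - t * succProb l)) + 1 / 4 := by
  rw [expect_surv]
  simp only [testIdx, Finset.sum_map, Function.Embedding.inl_apply]
  have h1 : ∀ i ∈ (star (itemInc U L t) (Sum.inr (u, α))).filter (fun i => i.isLeft),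
      (expect (actWeight (itemInc U L t) l) fun ω => ∏ z ∈ testSet U L t (Sum.inl (Sum.inr (u, α)))
        (Sum.inl i), uncInd (itemInc U L t) z ω) ≤
      (1 - l * succProb l) * (1 - t * succProb l) + 2 * actProb l := by
    intro i hi
    rw [Finset.mem_filter] at hi
    rcases i with ⟨f, α'⟩ | y
    · rw [mem_star, inr_mem_itemInc_inl] at hi
      obtain ⟨⟨⟨hf, hα⟩, huf, rfl⟩, -⟩ := hi
      obtain ⟨v, rfl⟩ := Sym2.mem_iff_exists.1 huf
      have huv : u ≠ v := fun h => hU _ hf (Sym2.mk_isDiag_iff.2 h)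
      have hne : (Sum.inl s(u, v) : Sym2 V ⊕ V × β) ≠ Sum.inr (v, α) := by simp
      simp only [testSet_inl_inr huv hf hα, Finset.prod_pair hne]
      have := (abs_le.1 (H.expect_uncInd_mul hne)).2
      rw [card_star_inr hc, card_star_inl hf, hL _ hf] at this
      linarith
    · simp at hi
  have h2 := Finset.sum_le_card_nsmul _ _ _ h1
  rw [nsmul_eq_mul] at h2
  refine h2.trans ?_
  have h3 : (((star (itemInc U L t) (Sum.inr (u, α))).filter (fun i => i.isLeft)).card : ℝ) ≤ t := by
    exact_mod_cast (Finset.card_le_card (Finset.filter_subset _ _)).trans_eq (card_star_inr hc u α)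
  have h4 := H.mul_actProb
  have h5 := H.actProb_pos
  have h6 := H.mul_succProb_le
  have h7 : (t : ℝ) ≤ l := by exact_mod_cast htl
  have h8 := H.succProb_pos
  have h9 : t * succProb l ≤ l * succProb l := mul_le_mul_of_nonneg_right h7 h8.le
  have h10 : 0 ≤ (1 - l * succProb l) * (1 - t * succProb l) :=
    mul_nonneg (by linarith) (by linarith)
  calc _ ≤ t * ((1 - l * succProb l) * (1 - t * succProb l) + 2 * actProb l) :=
        mul_le_mul_of_nonneg_right h3 (by linarith)
    _ ≤ _ := by nlinarith

lemma expect_surv_vertex (H : IsBoundedLinear (itemInc U L t) l)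
    (hL : ∀ e ∈ U, (L e).card = l) (v : V) (hMU : M v ⊆ U) :
    expect (actWeight (itemInc U L t) l)
      (surv (itemInc U L t) (testIdx U L t M (Sum.inr v)) (testSet U L t (Sum.inr v))) =
      (M v).card * (1 - l * succProb l) := by
  rw [expect_surv]
  simp only [testIdx, Finset.sum_map, testSet, Function.Embedding.trans_apply,
    Function.Embedding.inl_apply, Function.Embedding.inr_apply, Finset.prod_singleton]
  have h : ∀ e ∈ M v, expect (actWeight (itemInc U L t) l)
      (fun ω => uncInd (itemInc U L t) (Sum.inl e) ω) = 1 - l * succProb l := fun e he => by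
    have := H.expect_uncInd (Sum.inl e)
    rw [card_star_inl (hMU he), hL e (hMU he)] at this
    exact this
  rw [Finset.sum_congr rfl h, Finset.sum_const, nsmul_eq_mul]

end ColourStep

section ColourStep

variable {V β : Type*} [Fintype V] [DecidableEq V] [Fintype β] [DecidableEq β]
variable {U : Finset (Sym2 V)} {L : Sym2 V → Finset β} {l t : ℕ}

open scoped Classical in
/-- The edges which are uncoloured after one step of the random selection. -/
noncomputable def restEdges (U : Finset (Sym2 V)) (L : Sym2 V → Finset β) (t : ℕ)
    (ω : (Sym2 V × β) ⊕ (V × β × Fin t) → Option Bool) : Finset (Sym2 V) :=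
  U.filter fun e => ¬ Cov (itemInc U L t) ω (Sum.inl e)

open scoped Classical in
/-- The lists after one step of the random selection. -/
noncomputable def restLists (U : Finset (Sym2 V)) (L : Sym2 V → Finset β) (t : ℕ)
    (ω : (Sym2 V × β) ⊕ (V × β × Fin t) → Option Bool) (e : Sym2 V) : Finset β :=
  (L e).filter fun α => ∀ v ∈ e, ¬ Cov (itemInc U L t) ω (Sum.inr (v, α))

variable {M : V → Finset (Sym2 V)} {ω : (Sym2 V × β) ⊕ (V × β × Fin t) → Option Bool}

lemma surv_edge_le {e : Sym2 V} (he : e ∈ U) :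
    surv (itemInc U L t) (testIdx U L t M (Sum.inl (Sum.inl e)))
      (testSet U L t (Sum.inl (Sum.inl e))) ω ≤ (restLists U L t ω e).card := by
  classical
  rw [surv_eq_card]
  refine Nat.cast_le.2 ((Finset.card_le_card (t := (restLists U L t ω e).image
    fun α => Sum.inl (Sum.inl (e, α))) ?_).trans Finset.card_image_le)
  intro k hk
  rw [Finset.mem_filter] at hk
  obtain ⟨hk, hk'⟩ := hk
  simp only [testIdx, Finset.mem_map, Finset.mem_filter, mem_star] at hk
  obtain ⟨⟨f, α⟩ | y, ⟨hi, -⟩, rfl⟩ := hk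
  · rw [inl_mem_itemInc_inl] at hi
    obtain ⟨⟨-, hα⟩, rfl⟩ := hi
    refine Finset.mem_image.2 ⟨α, Finset.mem_filter.2 ⟨hα, fun v hv => ?_⟩, rfl⟩
    obtain ⟨u, rfl⟩ := Sym2.mem_iff_exists.1 hv
    refine hk' _ ?_
    simp only [Function.Embedding.inl_apply, testSet_inl_inl he hα]
    simp
  · exact absurd hi inl_notMem_itemInc_inr

lemma le_surv_colour (hU : ∀ e ∈ U, ¬ e.IsDiag) (u : V) (α : β) :
    (cdeg (restEdges U L t ω) (restLists U L t ω) u α : ℝ) ≤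
      surv (itemInc U L t) (testIdx U L t M (Sum.inl (Sum.inr (u, α))))
        (testSet U L t (Sum.inl (Sum.inr (u, α)))) ω := by
  classical
  rw [surv_eq_card, cdeg]
  refine Nat.cast_le.2 (Finset.card_le_card_of_injOn (fun e => Sum.inl (Sum.inl (e, α))) ?_ ?_)
  · intro e he
    simp only [Finset.coe_filter, Set.mem_ofPred_eq, restEdges, restLists, Finset.mem_filter] at he
    obtain ⟨⟨he, hcov⟩, hue, hα, hcov'⟩ := he
    obtain ⟨v, rfl⟩ := Sym2.mem_iff_exists.1 hue
    have huv : u ≠ v := fun h => hU _ he (Sym2.mk_isDiag_iff.2 h)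
    simp only [Finset.coe_filter, Set.mem_ofPred_eq, testIdx, Finset.mem_map, Finset.mem_filter,
      mem_star]
    refine ⟨⟨_, ⟨inr_mem_itemInc_inl.2 ⟨⟨he, hα⟩, hue, rfl⟩, rfl⟩, rfl⟩, ?_⟩
    rw [testSet_inl_inr huv he hα]
    simp only [Finset.mem_insert, Finset.mem_singleton, forall_eq_or_imp, forall_eq]
    exact ⟨hcov, hcov' v (Sym2.mem_mk_right _ _)⟩
  · intro e _ f _ h
    simpa using h

lemma surv_vertex_le (v : V) (hMU : M v ⊆ U) :
    surv (itemInc U L t) (testIdx U L t M (Sum.inr v)) (testSet U L t (Sum.inr v)) ω ≤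
      (M v ∩ restEdges U L t ω).card := by
  classical
  rw [surv_eq_card]
  refine Nat.cast_le.2 ((Finset.card_le_card (t := (M v ∩ restEdges U L t ω).image
    fun e => Sum.inr (Sum.inl e)) ?_).trans Finset.card_image_le)
  intro k hk
  rw [Finset.mem_filter] at hk
  obtain ⟨hk, hk'⟩ := hk
  simp only [testIdx, Finset.mem_map] at hk
  obtain ⟨e, he, rfl⟩ := hk
  refine Finset.mem_image.2 ⟨e, Finset.mem_inter.2 ⟨he, Finset.mem_filter.2 ⟨hMU he, ?_⟩⟩, rfl⟩
  refine hk' _ ?_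
  simp [testSet]

/-- One step of the colouring procedure: a partial proper colouring after which the lists, the
colour degrees and given sets of edges at the vertices shrink as expected. -/
theorem exists_colour_step (hU : ∀ e ∈ U, ¬ e.IsDiag) (hl : 0 < l) (htl : t ≤ l)
    (hL : ∀ e ∈ U, (L e).card = l) (hc : ∀ v α, cdeg U L v α ≤ t)
    (hMU : ∀ v, M v ⊆ U) (hMv : ∀ v, ∀ e ∈ M v, v ∈ e) (hM : ∀ v, (M v).card ≤ l)
    {a τ : ℝ} (ha0 : 0 ≤ a) (ha : 24 * a ≤ 1)
    (hexp : 7680 * (l : ℝ) ^ 5 * Real.exp (36 * a ^ 2 * l - a * τ) ≤ 1) :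
    ∃ U' ⊆ U, ∃ (L' : Sym2 V → Finset β) (col : Sym2 V → Option β),
      (∀ e, L' e ⊆ L e) ∧ (∀ e ∈ U \ U', ∃ α ∈ L e, col e = some α) ∧
      (∀ e ∈ U \ U', ∀ f ∈ U \ U', e ≠ f → ∀ v, v ∈ e → v ∈ f → col e ≠ col f) ∧
      (∀ e ∈ U', ∀ α ∈ L' e, ∀ f ∈ U \ U', ∀ v, v ∈ e → v ∈ f → col f ≠ some α) ∧
      (∀ e ∈ U', l * (1 - t * succProb l) ^ 2 - 1 / 4 - 2 * τ ≤ (L' e).card) ∧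
      (∀ v α, (cdeg U' L' v α : ℝ) ≤
        t * ((1 - l * succProb l) * (1 - t * succProb l)) + 1 / 4 + 2 * τ) ∧
      ∀ v, (M v).card * (1 - l * succProb l) - 2 * τ ≤ (M v ∩ U').card := by
  classical
  have H : IsBoundedLinear (itemInc U L t) l := isBoundedLinear_itemInc hl htl hL hc
  obtain ⟨ω, hω⟩ := H.exists_surv_close (testIdx U L t M) (testSet U L t)
    pairwiseDisjoint_testSet (card_testIdx_le H hM) card_testSet_le
    (card_filter_mem_testSet_le H hMv) ha0 ha hexp
  have hcov : ∀ e ∈ U \ restEdges U L t ω, ∃ α ∈ L e, Succ (itemInc U L t) ω (Sum.inl (e, α)) := by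
    intro e he
    rw [Finset.mem_sdiff] at he
    have h : Cov (itemInc U L t) ω (Sum.inl e) := by
      by_contra h
      exact he.2 (Finset.mem_filter.2 ⟨he.1, h⟩)
    obtain ⟨⟨f, α⟩ | y, hi, hs⟩ := h
    · rw [mem_star, inl_mem_itemInc_inl] at hi
      obtain ⟨⟨-, hα⟩, rfl⟩ := hi
      exact ⟨α, hα, hs⟩
    · exact absurd (mem_star.1 hi) inl_notMem_itemInc_inr
  choose! g hgL hgS using fun e : {e // e ∈ U \ restEdges U L t ω} => hcov e e.2
  let col : Sym2 V → Option β := fun e => if h : e ∈ U \ restEdges U L t ω then some (g ⟨e, h⟩) else none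
  have hcol : ∀ e ∈ U \ restEdges U L t ω, ∃ α ∈ L e, col e = some α ∧
      Succ (itemInc U L t) ω (Sum.inl (e, α)) := fun e he =>
    ⟨g ⟨e, he⟩, hgL _, by simp only [col, dif_pos he], hgS ⟨e, he⟩⟩
  refine ⟨restEdges U L t ω, Finset.filter_subset _ _, restLists U L t ω, col,
    fun e => Finset.filter_subset _ _, ?_, ?_, ?_, ?_, ?_, ?_⟩
  · intro e he
    obtain ⟨α, h1, h2, -⟩ := hcol e he
    exact ⟨α, h1, h2⟩
  · intro e he f hf hef v hve hvf h
    obtain ⟨α, h1, h2, h3⟩ := hcol e he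
    obtain ⟨α', h1', h2', h3'⟩ := hcol f hf
    rw [h2, h2', Option.some_inj] at h
    subst h
    have := succ_unique (z := Sum.inr (v, α))
      (mem_star.2 (inr_mem_itemInc_inl.2 ⟨⟨(Finset.mem_sdiff.1 he).1, h1⟩, hve, rfl⟩))
      (mem_star.2 (inr_mem_itemInc_inl.2 ⟨⟨(Finset.mem_sdiff.1 hf).1, h1'⟩, hvf, rfl⟩)) h3 h3'
    simp only [Sum.inl.injEq, Prod.mk.injEq, and_true] at this
    exact hef this
  · intro e he α hα f hf v hve hvf h
    obtain ⟨α', h1, h2, h3⟩ := hcol f hf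
    rw [h2, Option.some_inj] at h
    subst h
    exact (Finset.mem_filter.1 hα).2 v hve ⟨_, mem_star.2
      (inr_mem_itemInc_inl.2 ⟨⟨(Finset.mem_sdiff.1 hf).1, h1⟩, hvf, rfl⟩), h3⟩
  · intro e he
    have heU : e ∈ U := (Finset.mem_filter.1 he).1
    have h1 := (abs_lt.1 (hω (Sum.inl (Sum.inl e)))).1
    have h2 := expect_surv_edge (M := M) H hU hL hc heU
    have h3 := surv_edge_le (L := L) (t := t) (M := M) (ω := ω) heU
    linarith
  · intro v α
    have h1 := (abs_lt.1 (hω (Sum.inl (Sum.inr (v, α))))).2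
    have h2 := expect_surv_colour (M := M) H hU htl hL hc v α
    have h3 := le_surv_colour (L := L) (t := t) (M := M) (ω := ω) hU v α
    linarith
  · intro v
    have h1 := (abs_lt.1 (hω (Sum.inr v))).1
    have h2 := expect_surv_vertex H hL v (hMU v)
    have h3 := surv_vertex_le (L := L) (t := t) (ω := ω) v (hMU v)
    linarith

end ColourStep

section Uniform

variable {ι β : Type*} [Fintype ι] [DecidableEq ι] [DecidableEq β] {l t : ℕ}

/-- The uniform weights on `Fin l`. -/
noncomputable def unifWeight (ι : Type*) (l : ℕ) : ι → Fin l → ℝ := fun _ _ => 1 / l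

lemma isProbWeight_unifWeight (hl : 0 < l) : IsProbWeight (unifWeight ι l) where
  nonneg _ _ := by simp only [unifWeight]; positivity
  sum_eq_one _ := by
    have : (l : ℝ) ≠ 0 := by positivity
    simp [unifWeight, this]

lemma IsProbWeight.prob_le_of_forall_resample {K : Type*} [Fintype K] {w : ι → K → ℝ}
    (hw : IsProbWeight w) {A : (ι → K) → Prop} {p : ℝ} (W : Finset ι)
    (h : ∀ ω, prob w (fun η => A (W.piecewise η ω)) ≤ p) : prob w A ≤ p := by
  classical
  rw [prob, ← hw.expect_avg W]
  calc _ ≤ expect w fun _ => p := hw.expect_mono h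
    _ = p := hw.expect_const p

lemma IsProbWeight.prob_le_sum {K γ : Type*} [Fintype K] {w : ι → K → ℝ}
    (hw : IsProbWeight w) {A : (ι → K) → Prop} (s : Finset γ) (B : γ → (ι → K) → Prop)
    (h : ∀ η, A η → ∃ g ∈ s, B g η) : prob w A ≤ ∑ g ∈ s, prob w (B g) := by
  classical
  simp only [prob]
  rw [← expect_sum]
  refine hw.expect_mono fun η => ?_
  have h0 : ∀ g ∈ s, (0 : ℝ) ≤ if B g η then 1 else 0 := fun g _ => by
    split_ifs <;> norm_num
  split_ifs with hA
  · obtain ⟨g, hg, hB⟩ := h η hA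
    calc (1 : ℝ) = if B g η then 1 else 0 := by simp [hB]
      _ ≤ _ := Finset.single_le_sum (f := fun g => if B g η then (1 : ℝ) else 0) h0 hg
  · exact Finset.sum_nonneg h0

lemma prob_eq_zero {K : Type*} [Fintype K] (w : ι → K → ℝ) {A : (ι → K) → Prop}
    (h : ∀ η, ¬ A η) : prob w A = 0 := by
  classical
  simp [prob, expect, h]

lemma prob_forall_eq (hl : 0 < l) (S : Finset ι) (η₀ : ι → Fin l) :
    prob (unifWeight ι l) (fun η => ∀ i ∈ S, η i = η₀ i) = (1 / l) ^ S.card := by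
  classical
  have hw := isProbWeight_unifWeight (ι := ι) hl
  have h := expect_prod (unifWeight ι l) fun i k => if i ∈ S then (if k = η₀ i then 1 else 0) else 1
  have h1 : ∀ η : ι → Fin l, ((if ∀ i ∈ S, η i = η₀ i then 1 else 0 : ℝ)) =
      ∏ i, if i ∈ S then (if η i = η₀ i then 1 else 0) else 1 := by
    intro η
    rw [Finset.prod_ite_mem, Finset.univ_inter, Finset.prod_ite_zero]
    simp
  have h2 : ∀ i, (∑ k, unifWeight ι l i k * if i ∈ S then (if k = η₀ i then 1 else 0) else 1) =
      if i ∈ S then (1 / l : ℝ) else 1 := by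
    intro i
    split_ifs
    · simp [unifWeight]
    · simpa using hw.sum_eq_one i
  rw [prob]
  calc _ = expect (unifWeight ι l) fun η => ∏ i, if i ∈ S then (if η i = η₀ i then 1 else 0) else 1 := by
        congr 1
        funext η
        convert h1 η
    _ = _ := by
        rw [h, Finset.prod_congr rfl fun i _ => h2 i, Finset.prod_ite_mem, Finset.univ_inter,
          Finset.prod_const]

/-- The probability that a random colouring maps `W` onto a set of `#W` colours. -/
lemma prob_image_eq_le (hl : 0 < l) (col : ι → Fin l → β) (W : Finset ι) (T : Finset β)
    (hWT : T.card = W.card) (hcol : ∀ i ∈ W, Function.Injective (col i))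
    (ht : ∀ α, (W.filter fun i => ∃ k, col i k = α).card ≤ t) :
    prob (unifWeight ι l) (fun η => W.image (fun i => col i (η i)) = T) ≤ (t / l) ^ W.card := by
  classical
  have hw := isProbWeight_unifWeight (ι := ι) hl
  let Q := T.pi fun α => W.filter fun i => ∃ k, col i k = α
  let B : (∀ α ∈ T, ι) → (ι → Fin l) → Prop := fun g η => ∀ α, ∀ h : α ∈ T, col (g α h) (η (g α h)) = α
  have hB : ∀ g ∈ Q, prob (unifWeight ι l) (B g) ≤ (1 / l) ^ W.card := by
    intro g hg
    rw [Finset.mem_pi] at hg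
    by_cases hne : ∃ η₀, B g η₀
    · obtain ⟨η₀, h0⟩ := hne
      let S := T.attach.image fun α => g α.1 α.2
      have hS : S.card = W.card := by
        rw [Finset.card_image_of_injective, Finset.card_attach, hWT]
        rintro ⟨α, hα⟩ ⟨α', hα'⟩ h
        have h1 := h0 α hα
        have h2 := h0 α' hα'
        simp only at h
        rw [h] at h1
        exact Subtype.ext (h1.symm.trans h2)
      rw [← hS, ← prob_forall_eq hl S η₀]
      refine hw.prob_mono fun η hη i hi => ?_
      obtain ⟨⟨α, hα⟩, -, rfl⟩ := Finset.mem_image.1 hi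
      exact hcol _ (Finset.mem_filter.1 (hg α hα)).1 ((hη α hα).trans (h0 α hα).symm)
    · push Not at hne
      rw [prob_eq_zero _ hne]
      positivity
  calc _ ≤ ∑ g ∈ Q, prob (unifWeight ι l) (B g) := by
        refine hw.prob_le_sum Q B fun η hη => ?_
        have h : ∀ α ∈ T, ∃ i ∈ W, col i (η i) = α := fun α hα => by
          rw [← hη] at hα
          simpa using hα
        choose g hgW hg using h
        exact ⟨g, Finset.mem_pi.2 fun α hα => Finset.mem_filter.2 ⟨hgW α hα, _, hg α hα⟩, hg⟩
    _ ≤ Q.card * (1 / l) ^ W.card := by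
        rw [← nsmul_eq_mul]
        exact Finset.sum_le_card_nsmul _ _ _ hB
    _ ≤ t ^ W.card * (1 / l) ^ W.card := by
        refine mul_le_mul_of_nonneg_right ?_ (by positivity)
        have : Q.card ≤ t ^ W.card := by
          rw [Finset.card_pi, ← hWT]
          exact Finset.prod_le_pow_card _ _ _ fun α _ => ht α
        exact_mod_cast this
    _ = _ := by rw [← mul_pow, mul_one_div]

end Uniform

section FinalStage

variable {V β : Type*} [Fintype V] [DecidableEq V] [DecidableEq β]
variable {U : Finset (Sym2 V)} {L : Sym2 V → Finset β} {l t : ℕ}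

/-- The edges of `U` at the vertex `v`. -/
def edgesAt (U : Finset (Sym2 V)) (v : V) : Finset (Sym2 V) := U.filter fun e => v ∈ e

lemma mem_edgesAt {v : V} {e : Sym2 V} : e ∈ edgesAt U v ↔ e ∈ U ∧ v ∈ e := by simp [edgesAt]

lemma card_edgesAt_le_card_sdiff {u v : V} (huv : u ≠ v) :
    (edgesAt U u).card ≤ (edgesAt U u \ edgesAt U v).card + 1 := by
  have h : (edgesAt U u ∩ edgesAt U v) ⊆ {s(u, v)} := by
    intro e he
    simp only [Finset.mem_inter, mem_edgesAt] at he
    exact Finset.mem_singleton.2 ((Sym2.mem_and_mem_iff huv).1 ⟨he.1.2, he.2.2⟩)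
  have h1 := Finset.card_le_card h
  rw [Finset.card_singleton] at h1
  have h2 := Finset.card_sdiff_add_card_inter (edgesAt U u) (edgesAt U v)
  omega

/-- The probability that a random colouring is injective at `u` and yields equal palettes at `u`
and `v`. -/
lemma prob_palette_eq_le (hl : 0 < l) (htl : t ≤ l) (col : Sym2 V → Fin l → β)
    (hcol : ∀ e ∈ U, Function.Injective (col e)) (hcolL : ∀ e ∈ U, ∀ α, α ∈ L e ↔ ∃ k, col e k = α)
    (hc : ∀ v α, cdeg U L v α ≤ t) {P : V → Finset β}
    (hP : ∀ e ∈ U, ∀ v ∈ e, Disjoint (L e) (P v)) {u v : V} (huv : u ≠ v) :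
    prob (unifWeight (Sym2 V) l) (fun η =>
      (∀ e ∈ edgesAt U u, ∀ f ∈ edgesAt U u, col e (η e) = col f (η f) → e = f) ∧
      P u ∪ (edgesAt U u).image (fun e => col e (η e)) =
        P v ∪ (edgesAt U v).image (fun e => col e (η e))) ≤
      (t / l) ^ ((edgesAt U u).card - 1) := by
  have hw := isProbWeight_unifWeight (ι := Sym2 V) hl
  set W := edgesAt U u \ edgesAt U v with hW
  have htl' : (t / l : ℝ) ≤ 1 := by
    rw [div_le_one (by exact_mod_cast hl)]
    exact_mod_cast htl
  have hWc : (edgesAt U u).card - 1 ≤ W.card := by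
    have := card_edgesAt_le_card_sdiff (U := U) huv
    rw [hW]
    omega
  refine le_trans ?_ (pow_le_pow_of_le_one (by positivity) htl' hWc)
  refine hw.prob_le_of_forall_resample W fun ω => ?_
  set T := (P v ∪ (edgesAt U v).image (fun e => col e (ω e))) \
    (P u ∪ (edgesAt U u ∩ edgesAt U v).image (fun e => col e (ω e))) with hT
  have key : ∀ η : Sym2 V → Fin l,
      ((∀ e ∈ edgesAt U u, ∀ f ∈ edgesAt U u,
        col e (W.piecewise η ω e) = col f (W.piecewise η ω f) → e = f) ∧
      P u ∪ (edgesAt U u).image (fun e => col e (W.piecewise η ω e)) =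
        P v ∪ (edgesAt U v).image (fun e => col e (W.piecewise η ω e))) →
      W.image (fun e => col e (η e)) = T ∧ T.card = W.card := by
    rintro η ⟨hinj, hpal⟩
    have hin : ∀ e ∈ W, W.piecewise η ω e = η e := fun e he => by simp [he]
    have hout : ∀ e ∈ edgesAt U v, W.piecewise η ω e = ω e := fun e he => by
      have : e ∉ W := by simp [hW, he]
      simp [this]
    have hWu : W ⊆ edgesAt U u := Finset.sdiff_subset
    have h1 : (edgesAt U v).image (fun e => col e (W.piecewise η ω e)) =
        (edgesAt U v).image (fun e => col e (ω e)) :=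
      Finset.image_congr fun e he => by simp only [hout e he]
    have h2 : W.image (fun e => col e (η e)) = T := by
      rw [hT, ← h1, ← hpal]
      ext α
      simp only [Finset.mem_image, Finset.mem_sdiff, Finset.mem_union, Finset.mem_inter, not_or,
        not_exists, not_and]
      constructor
      · rintro ⟨e, he, rfl⟩
        refine ⟨Or.inr ⟨e, hWu he, by rw [hin e he]⟩, ?_, ?_⟩
        · have heU := mem_edgesAt.1 (hWu he)
          exact Finset.disjoint_left.1 (hP e heU.1 u heU.2) ((hcolL e heU.1 _).2 ⟨_, rfl⟩)
        · intro f hf h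
          rw [← hout f hf.2, ← hin e he] at h
          have := hinj f hf.1 e (hWu he) h
          rw [this] at hf
          exact (Finset.mem_sdiff.1 he).2 hf.2
      · rintro ⟨h | ⟨e, he, rfl⟩, h3, h4⟩
        · exact absurd h h3
        · have heW : e ∈ W := by
            rw [hW, Finset.mem_sdiff]
            refine ⟨he, fun hev => h4 e ⟨he, hev⟩ (by rw [hout e hev])⟩
          exact ⟨e, heW, by rw [hin e heW]⟩
    refine ⟨h2, ?_⟩
    rw [← h2, Finset.card_image_of_injOn]
    intro e he f hf h
    simp only at h
    rw [← hin e he, ← hin f hf] at h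
    exact hinj e (hWu he) f (hWu hf) h
  by_cases hcard : T.card = W.card
  · refine (hw.prob_mono fun η hη => (key η hη).1).trans
      (prob_image_eq_le hl col W T hcard (fun e he => hcol e ?_) fun α => ?_)
    · exact (mem_edgesAt.1 (Finset.mem_sdiff.1 he).1).1
    · refine (Finset.card_le_card fun e he => ?_).trans (hc u α)
      rw [Finset.mem_filter] at he
      have := mem_edgesAt.1 (Finset.mem_sdiff.1 he.1).1
      exact Finset.mem_filter.2 ⟨this.1, this.2, (hcolL e this.1 α).2 he.2⟩
  · rw [prob_eq_zero _ fun η hη => hcard (key η hη).2]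
    positivity

/-- If the lists are much larger than the colour degrees, there is a colouring which is proper
and gives distinct palettes to adjacent vertices. -/
theorem exists_colouring_of_large_lists [Fintype β] [Nonempty β] (G : SimpleGraph V)
    [DecidableRel G.Adj] (hl3 : 3 ≤ l) (htl : 128 * t ≤ l)
    (hL : ∀ e ∈ U, (L e).card = l) (hc : ∀ v α, cdeg U L v α ≤ t) {P : V → Finset β}
    (hP : ∀ e ∈ U, ∀ v ∈ e, Disjoint (L e) (P v)) {m : ℕ} (hm2 : 2 ≤ m)
    (hm : ∀ v, m ≤ (edgesAt U v).card) (hmax : 32 * G.maxDegree ≤ 3 * 2 ^ m) :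
    ∃ c : Sym2 V → β, (∀ e ∈ U, c e ∈ L e) ∧
      (∀ e ∈ U, ∀ f ∈ U, e ≠ f → ∀ v, v ∈ e → v ∈ f → c e ≠ c f) ∧
      ∀ u v, G.Adj u v → P u ∪ (edgesAt U u).image c ≠ P v ∪ (edgesAt U v).image c := by
  classical
  have hl : 0 < l := by omega
  have hw := isProbWeight_unifWeight (ι := Sym2 V) hl
  have hlR : (0 : ℝ) < l := by exact_mod_cast hl
  have htlR : (t / l : ℝ) ≤ 1 / 128 := by
    rw [div_le_iff₀ hlR]
    have : (128 * t : ℝ) ≤ l := by exact_mod_cast htl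
    linarith
  obtain ⟨col, hcol⟩ : ∃ col : Sym2 V → Fin l → β, ∀ e ∈ U, Function.Injective (col e) ∧
      ∀ α, α ∈ L e ↔ ∃ k, col e k = α := by
    have : ∀ e, ∃ g : Fin l → β, e ∈ U → Function.Injective g ∧ ∀ α, α ∈ L e ↔ ∃ k, g k = α := by
      intro e
      by_cases he : e ∈ U
      · let φ := (L e).equivFinOfCardEq (hL e he)
        refine ⟨fun k => φ.symm k, fun _ => ⟨Subtype.val_injective.comp φ.symm.injective,
          fun α => ⟨fun h => ⟨φ ⟨α, h⟩, by simp⟩, ?_⟩⟩⟩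
        rintro ⟨k, rfl⟩
        exact (φ.symm k).2
      · exact ⟨fun _ => Classical.arbitrary β, fun h => absurd h he⟩
    choose col hcol using this
    exact ⟨col, hcol⟩
  let vA : Sym2 V × Sym2 V × β → Prop := fun j =>
    (j.1 ∈ U ∧ j.2.1 ∈ U ∧ j.1 ≠ j.2.1) ∧ (∃ v, v ∈ j.1 ∧ v ∈ j.2.1) ∧
      j.2.2 ∈ L j.1 ∧ j.2.2 ∈ L j.2.1
  let vB : V × V → Prop := fun j =>
    G.Adj j.1 j.2 ∧ (edgesAt U j.2).card ≤ (edgesAt U j.1).card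
  let A : (Sym2 V × Sym2 V × β) ⊕ (V × V) → (Sym2 V → Fin l) → Prop := Sum.elim
    (fun j ω => vA j ∧ col j.1 (ω j.1) = j.2.2 ∧ col j.2.1 (ω j.2.1) = j.2.2)
    (fun j ω => vB j ∧
      (∀ e ∈ edgesAt U j.1, ∀ f ∈ edgesAt U j.1, col e (ω e) = col f (ω f) → e = f) ∧
      P j.1 ∪ (edgesAt U j.1).image (fun e => col e (ω e)) =
        P j.2 ∪ (edgesAt U j.2).image (fun e => col e (ω e)))
  let D : (Sym2 V × Sym2 V × β) ⊕ (V × V) → Finset (Sym2 V) := Sum.elim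
    (fun j => if vA j then {j.1, j.2.1} else ∅)
    (fun j => if vB j then edgesAt U j.1 ∪ edgesAt U j.2 else ∅)
  let x : (Sym2 V × Sym2 V × β) ⊕ (V × V) → ℝ := Sum.elim
    (fun j => if vA j then 4 * (1 / l) ^ 2 else 0)
    (fun j => if vB j then (1 / 2) ^ (edgesAt U j.1).card else 0)
  obtain ⟨ω, hω⟩ : ∃ ω, ∀ j, ¬ A j ω := by
    refine exists_forall_not_of_weighted hw A D ?_ x ?_ ?_ ?_ ?_
    · rintro (j | j) ω ω' h
      · by_cases hv : vA j
        · have h1 : ω j.1 = ω' j.1 := h _ (by simp [D, hv])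
          have h2 : ω j.2.1 = ω' j.2.1 := h _ (by simp [D, hv])
          simp only [A, Sum.elim_inl, h1, h2]
        · simp only [A, Sum.elim_inl, hv, false_and]
      · by_cases hv : vB j
        · have h1 : ∀ e ∈ edgesAt U j.1, ω e = ω' e := fun e he => h _ (by simp [D, hv, he])
          have h2 : ∀ e ∈ edgesAt U j.2, ω e = ω' e := fun e he => h _ (by simp [D, hv, he])
          have h3 : (edgesAt U j.1).image (fun e => col e (ω e)) =
              (edgesAt U j.1).image (fun e => col e (ω' e)) :=
            Finset.image_congr fun e he => by simp only [h1 e he]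
          have h4 : (edgesAt U j.2).image (fun e => col e (ω e)) =
              (edgesAt U j.2).image (fun e => col e (ω' e)) :=
            Finset.image_congr fun e he => by simp only [h2 e he]
          have h5 : (∀ e ∈ edgesAt U j.1, ∀ f ∈ edgesAt U j.1, col e (ω e) = col f (ω f) → e = f) ↔
              ∀ e ∈ edgesAt U j.1, ∀ f ∈ edgesAt U j.1, col e (ω' e) = col f (ω' f) → e = f :=
            forall₂_congr fun e he => forall₂_congr fun f hf => by rw [h1 e he, h1 f hf]
          simp only [A, Sum.elim_inr, h3, h4, h5]
        · simp only [A, Sum.elim_inr, hv, false_and]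
    · rintro (j | j) <;> simp only [x, Sum.elim_inl, Sum.elim_inr] <;> split_ifs <;> positivity
    · rintro (j | j) <;> simp only [x, Sum.elim_inl, Sum.elim_inr] <;> split_ifs
      · have h1 : (1 / l : ℝ) ≤ 1 / 3 := one_div_le_one_div_of_le (by norm_num) (by exact_mod_cast hl3)
        have h2 : (0 : ℝ) ≤ 1 / l := by positivity
        nlinarith
      · norm_num
      · calc ((1 : ℝ) / 2) ^ (edgesAt U j.1).card ≤ (1 / 2) ^ 1 :=
              pow_le_pow_of_le_one (by norm_num) (by norm_num) (by have := hm j.1; omega)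
          _ = 1 / 2 := by norm_num
      · norm_num
    · intro i
      rw [Finset.sum_filter, Fintype.sum_sum_type, ← Finset.sum_filter, ← Finset.sum_filter]
      have h1 : ∑ j ∈ univ.filter (fun j => i ∈ D (Sum.inl j)), x (Sum.inl j) ≤ 1 / 8 := by
        have hcard : (univ.filter fun j => i ∈ D (Sum.inl j)).card ≤ 4 * l * t := by
          by_cases hi : i ∈ U
          · let X : Finset (V × β) := i.toFinset ×ˢ L i
            have hX : X.card ≤ 2 * l := by
              rw [Finset.card_product, hL i hi]
              exact Nat.mul_le_mul_right _ (card_sym2_toFinset_le i)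
            have hb : ∀ g : Sym2 V → β → Sym2 V × Sym2 V × β, (X.biUnion fun y =>
                (U.filter fun f => y.1 ∈ f ∧ y.2 ∈ L f).image fun f => g f y.2).card ≤ 2 * l * t := by
              intro g
              refine (Finset.card_biUnion_le_card_mul _ _ t fun y _ => ?_).trans
                (Nat.mul_le_mul_right _ hX)
              exact Finset.card_image_le.trans (hc y.1 y.2)
            refine (Finset.card_le_card (t := (X.biUnion fun y =>
                (U.filter fun f => y.1 ∈ f ∧ y.2 ∈ L f).image fun f => (i, f, y.2)) ∪
              (X.biUnion fun y =>
                (U.filter fun f => y.1 ∈ f ∧ y.2 ∈ L f).image fun f => (f, i, y.2))) ?_).trans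
              ((Finset.card_union_le _ _).trans ?_)
            · rintro ⟨e, f, α⟩ hj
              rw [Finset.mem_filter] at hj
              have hj := hj.2
              simp only [D, Sum.elim_inl] at hj
              split_ifs at hj with hv
              · obtain ⟨⟨he, hf, -⟩, ⟨v, hve, hvf⟩, hαe, hαf⟩ := hv
                simp only at he hf hve hvf hαe hαf
                rw [Finset.mem_insert, Finset.mem_singleton] at hj
                rcases hj with rfl | rfl
                · exact Finset.mem_union_left _ (Finset.mem_biUnion.2 ⟨(v, α),
                    Finset.mem_product.2 ⟨Sym2.mem_toFinset.2 hve, hαe⟩,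
                    Finset.mem_image.2 ⟨f, Finset.mem_filter.2 ⟨hf, hvf, hαf⟩, rfl⟩⟩)
                · exact Finset.mem_union_right _ (Finset.mem_biUnion.2 ⟨(v, α),
                    Finset.mem_product.2 ⟨Sym2.mem_toFinset.2 hvf, hαf⟩,
                    Finset.mem_image.2 ⟨e, Finset.mem_filter.2 ⟨he, hve, hαe⟩, rfl⟩⟩)
              · simp at hj
            · have h1 := hb fun f α => (i, f, α)
              have h2 := hb fun f α => (f, i, α)
              linarith
          · rw [Finset.filter_eq_empty_iff.2]
            · simp
            · rintro ⟨e, f, α⟩ - hj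
              simp only [D, Sum.elim_inl] at hj
              split_ifs at hj with hv
              · rw [Finset.mem_insert, Finset.mem_singleton] at hj
                rcases hj with rfl | rfl
                · exact hi hv.1.1
                · exact hi hv.1.2.1
              · simp at hj
        have hx : ∀ j ∈ univ.filter (fun j => i ∈ D (Sum.inl j)), x (Sum.inl j) ≤ 4 * (1 / l) ^ 2 := by
          intro j _
          simp only [x, Sum.elim_inl]
          split_ifs
          · exact le_rfl
          · positivity
        refine (Finset.sum_le_card_nsmul _ _ _ hx).trans ?_
        rw [nsmul_eq_mul]
        calc _ ≤ ((4 * l * t : ℕ) : ℝ) * (4 * (1 / l) ^ 2) :=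
              mul_le_mul_of_nonneg_right (by exact_mod_cast hcard) (by positivity)
          _ = 16 * (t / l) := by
              push_cast
              field_simp
              ring
          _ ≤ 1 / 8 := by linarith
      have h2 : ∑ j ∈ univ.filter (fun j => i ∈ D (Sum.inr j)), x (Sum.inr j) ≤ 3 / 8 := by
        have hcard : (univ.filter fun j => i ∈ D (Sum.inr j)).card ≤ 4 * G.maxDegree := by
          have hb : ∀ g : V → V → V × V, (i.toFinset.biUnion fun u =>
              (G.neighborFinset u).image fun v => g u v).card ≤ 2 * G.maxDegree :=
            fun g => (Finset.card_biUnion_le_card_mul _ _ G.maxDegree fun u _ =>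
              Finset.card_image_le.trans (by
                rw [G.card_neighborFinset_eq_degree]
                exact G.degree_le_maxDegree u)).trans
              (Nat.mul_le_mul_right _ (card_sym2_toFinset_le i))
          refine (Finset.card_le_card (t := (i.toFinset.biUnion fun u =>
              (G.neighborFinset u).image fun v => (u, v)) ∪ (i.toFinset.biUnion fun u =>
              (G.neighborFinset u).image fun v => (v, u))) ?_).trans
              ((Finset.card_union_le _ _).trans ?_)
          · rintro ⟨u, v⟩ hj
            rw [Finset.mem_filter] at hj
            have hj := hj.2
            simp only [D, Sum.elim_inr] at hj
            split_ifs at hj with hv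
            · rw [Finset.mem_union, mem_edgesAt, mem_edgesAt] at hj
              have hadj : G.Adj u v := hv.1
              rcases hj with hj | hj
              · exact Finset.mem_union_left _ (Finset.mem_biUnion.2 ⟨u, Sym2.mem_toFinset.2 hj.2,
                  Finset.mem_image.2 ⟨v, by simpa using hadj, rfl⟩⟩)
              · exact Finset.mem_union_right _ (Finset.mem_biUnion.2 ⟨v, Sym2.mem_toFinset.2 hj.2,
                  Finset.mem_image.2 ⟨u, by simpa using hadj.symm, rfl⟩⟩)
            · simp at hj
          · have h1 := hb fun u v => (u, v)
            have h2 := hb fun u v => (v, u)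
            linarith
        have hx : ∀ j ∈ univ.filter (fun j => i ∈ D (Sum.inr j)), x (Sum.inr j) ≤ (1 / 2) ^ m := by
          intro j _
          simp only [x, Sum.elim_inr]
          split_ifs
          · exact pow_le_pow_of_le_one (by norm_num) (by norm_num) (hm _)
          · positivity
        refine (Finset.sum_le_card_nsmul _ _ _ hx).trans ?_
        rw [nsmul_eq_mul]
        have hmax' : (32 * G.maxDegree : ℝ) ≤ 3 * 2 ^ m := by exact_mod_cast hmax
        calc _ ≤ ((4 * G.maxDegree : ℕ) : ℝ) * (1 / 2) ^ m :=
              mul_le_mul_of_nonneg_right (by exact_mod_cast hcard) (by positivity)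
          _ ≤ 3 / 8 * 2 ^ m * (1 / 2) ^ m := by
              refine mul_le_mul_of_nonneg_right ?_ (by positivity)
              push_cast
              linarith
          _ = 3 / 8 := by
              rw [mul_assoc, ← mul_pow]
              norm_num
      linarith
    · rintro (j | ⟨u, v⟩)
      · by_cases hv : vA j
        · have hne : j.1 ≠ j.2.1 := hv.1.2.2
          obtain ⟨k, hk⟩ := ((hcol _ hv.1.1).2 _).1 hv.2.2.1
          obtain ⟨k', hk'⟩ := ((hcol _ hv.1.2.1).2 _).1 hv.2.2.2
          have h1 : prob (unifWeight (Sym2 V) l) (A (Sum.inl j)) ≤ (1 / l) ^ 2 := by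
            have h2 := prob_forall_eq hl {j.1, j.2.1} (fun e => if e = j.1 then k else k')
            rw [Finset.card_pair hne] at h2
            rw [← h2]
            refine hw.prob_mono fun η hη => ?_
            obtain ⟨-, h3, h4⟩ := hη
            simp only [Finset.mem_insert, Finset.mem_singleton, forall_eq_or_imp, forall_eq, if_true,
              hne.symm, if_false]
            exact ⟨(hcol _ hv.1.1).1 (h3.trans hk.symm), (hcol _ hv.1.2.1).1 (h4.trans hk'.symm)⟩
          simp only [D, x, Sum.elim_inl, if_pos hv, Finset.card_pair hne]
          linarith
        · rw [prob_eq_zero _ fun η hη => hv hη.1]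
          simp [x, hv]
      · by_cases hv : vB (u, v)
        · obtain ⟨hadj, hd⟩ := id hv
          simp only at hadj hd
          have h1 : prob (unifWeight (Sym2 V) l) (A (Sum.inr (u, v))) ≤
              (t / l) ^ ((edgesAt U u).card - 1) :=
            (hw.prob_mono fun η hη => hη.2).trans (prob_palette_eq_le hl (by omega) col
              (fun e he => (hcol e he).1) (fun e he => (hcol e he).2) hc hP hadj.ne)
          simp only [D, x, Sum.elim_inr, if_pos hv]
          have hm' := hm u
          obtain ⟨d, hd'⟩ : ∃ d, (edgesAt U u).card = d + 2 := ⟨(edgesAt U u).card - 2, by omega⟩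
          have h2 : (edgesAt U u ∪ edgesAt U v).card ≤ 2 * (d + 2) := by
            refine (Finset.card_union_le _ _).trans ?_
            omega
          have h3 : (t / l : ℝ) ^ ((edgesAt U u).card - 1) ≤ (1 / 128) ^ (d + 1) := by
            rw [hd', show d + 2 - 1 = d + 1 by omega]
            exact pow_le_pow_left₀ (by positivity) htlR _
          calc _ ≤ (1 / 128 : ℝ) ^ (d + 1) * 2 ^ (2 * (d + 2)) :=
                mul_le_mul (h1.trans h3) (pow_le_pow_right₀ (by norm_num) h2) (by positivity)
                  (by positivity)
            _ = (1 / 32 : ℝ) ^ d * (1 / 8) := by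
                rw [pow_mul, pow_add, pow_add, show (1 / 32 : ℝ) = 1 / 128 * 2 ^ 2 by norm_num,
                  mul_pow]
                ring
            _ ≤ (1 / 2) ^ d * (1 / 4) := by
                gcongr <;> norm_num
            _ = _ := by rw [hd', pow_add]; norm_num
        · rw [prob_eq_zero _ fun η hη => hv hη.1]
          simp [x, hv]
  have hprop : ∀ e ∈ U, ∀ f ∈ U, e ≠ f → ∀ v, v ∈ e → v ∈ f → col e (ω e) ≠ col f (ω f) := by
    intro e he f hf hef v hve hvf h
    exact hω (Sum.inl (e, f, col e (ω e))) ⟨⟨⟨he, hf, hef⟩, ⟨v, hve, hvf⟩,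
      ((hcol e he).2 _).2 ⟨_, rfl⟩, ((hcol f hf).2 _).2 ⟨_, h.symm⟩⟩, rfl, h.symm⟩
  have hpal : ∀ u v, G.Adj u v → (edgesAt U v).card ≤ (edgesAt U u).card →
      P u ∪ (edgesAt U u).image (fun e => col e (ω e)) ≠
        P v ∪ (edgesAt U v).image (fun e => col e (ω e)) := by
    intro u v huv hd h
    refine hω (Sum.inr (u, v)) ⟨⟨huv, hd⟩, fun e he f hf hef => ?_, h⟩
    by_contra hne
    rw [mem_edgesAt] at he hf
    exact hprop e he.1 f hf.1 hne u he.2 hf.2 hef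
  refine ⟨fun e => col e (ω e), fun e he => ((hcol e he).2 _).2 ⟨_, rfl⟩, hprop, fun u v huv => ?_⟩
  rcases le_total (edgesAt U v).card (edgesAt U u).card with hd | hd
  · exact hpal u v huv hd
  · exact (hpal v u huv.symm hd).symm

end FinalStage

section Parameters

/-- The relation between the list size `l` and the bound `t` for the colour degrees which is
maintained during the colouring procedure. -/
def GoodParams (Λ : ℝ) (l t : ℕ) : Prop :=
  Λ ^ 2 * (1 + Real.log l) * √l ≤ (l : ℝ) - t ∧ Λ ^ 3 ≤ t

variable {Λ : ℝ} {l t : ℕ}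

namespace GoodParams

lemma le (h : GoodParams Λ l t) : t ≤ l := by
  have h1 : 0 ≤ Λ ^ 2 * (1 + Real.log l) * √l :=
    mul_nonneg (mul_nonneg (sq_nonneg _) (by linarith [Real.log_natCast_nonneg l]))
      (Real.sqrt_nonneg _)
  have : (t : ℝ) ≤ l := by linarith [h.1]
  exact_mod_cast this

lemma pos (h : GoodParams Λ l t) (hΛ : 10 ^ 7 ≤ Λ) : 0 < t := by
  have h1 : (0 : ℝ) < t := lt_of_lt_of_le (by positivity) h.2
  exact_mod_cast h1

lemma sq_le_sqrt (h : GoodParams Λ l t) (hΛ : 10 ^ 7 ≤ Λ) : Λ ^ 2 ≤ √l := by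
  have hl : (0 : ℝ) < l := by exact_mod_cast (h.pos hΛ).trans_le h.le
  have hs : 0 < √(l : ℝ) := Real.sqrt_pos.2 hl
  have h1 : Λ ^ 2 * 1 * √l ≤ Λ ^ 2 * (1 + Real.log l) * √l := by
    gcongr
    linarith [Real.log_natCast_nonneg l]
  have h2 : √(l : ℝ) * √l = l := Real.mul_self_sqrt hl.le
  have h3 : Λ ^ 2 * √l ≤ √l * √l := by
    have : (0 : ℝ) ≤ t := Nat.cast_nonneg t
    linarith [h.1]
  exact le_of_mul_le_mul_right h3 hs

end GoodParams

/-- The condition on the concentration of the random selection. -/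
lemma concentration_condition (h : GoodParams Λ l t) (hΛ : 10 ^ 7 ≤ Λ)
    (hl : (l : ℝ) ≤ 2 * Real.exp Λ) :
    24 * (20 / √l) ≤ 1 ∧ 7680 * (l : ℝ) ^ 5 *
      Real.exp (36 * (20 / √l) ^ 2 * l - 20 / √l * (Λ * √l)) ≤ 1 := by
  have h1 := h.sq_le_sqrt hΛ
  have hs : 480 ≤ √(l : ℝ) := by nlinarith
  have hs0 : 0 < √(l : ℝ) := by linarith
  have hl0 : (0 : ℝ) < l := Real.sqrt_pos.1 hs0
  constructor
  · rw [← mul_div_assoc, div_le_one hs0]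
    linarith
  · have h2 : 36 * (20 / √l) ^ 2 * l - 20 / √l * (Λ * √l) = 14400 - 20 * Λ := by
      rw [div_pow, Real.sq_sqrt hl0.le]
      field_simp
      ring
    rw [h2]
    have h3 : (l : ℝ) ^ 5 ≤ 32 * Real.exp (5 * Λ) := by
      calc (l : ℝ) ^ 5 ≤ (2 * Real.exp Λ) ^ 5 := pow_le_pow_left₀ hl0.le hl 5
        _ = 32 * Real.exp (5 * Λ) := by
          rw [mul_pow, ← Real.exp_nat_mul]
          norm_num
    have h4 : (245760 : ℝ) ≤ Real.exp (15 * Λ - 14400) := by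
      linarith [Real.add_one_le_exp (15 * Λ - 14400)]
    calc 7680 * (l : ℝ) ^ 5 * Real.exp (14400 - 20 * Λ)
        ≤ 7680 * (32 * Real.exp (5 * Λ)) * Real.exp (14400 - 20 * Λ) := by gcongr
      _ = 245760 * Real.exp (5 * Λ) * Real.exp (14400 - 20 * Λ) := by ring
      _ ≤ Real.exp (15 * Λ - 14400) * Real.exp (5 * Λ) * Real.exp (14400 - 20 * Λ) := by gcongr
      _ = 1 := by
        rw [← Real.exp_add, ← Real.exp_add, ← Real.exp_zero]
        congr 1
        ring

set_option maxHeartbeats 1000000 in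
/-- The parameters after one step of the colouring procedure. -/
lemma exists_next_params (h : GoodParams Λ l t) (hΛ : 10 ^ 7 ≤ Λ) (hlt : l < 128 * t) {s : ℝ}
    (hs1 : 5 / 64 ≤ l * s) (hs2 : l * s ≤ 1 / 8) :
    ∃ l' t' : ℕ, l' < l ∧ GoodParams Λ l' t' ∧
      (l' : ℝ) ≤ l * (1 - t * s) ^ 2 - 1 / 4 - 2 * (Λ * √l) ∧
      t * ((1 - l * s) * (1 - t * s)) + 1 / 4 + 2 * (Λ * √l) ≤ t' ∧
      ∀ m : ℝ, (t : ℝ) ≤ 8 * m → (t' : ℝ) ≤ 8 * (m * (1 - l * s) - 2 * (Λ * √l)) := by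
  have hr := h.sq_le_sqrt hΛ
  have htl : (t : ℝ) ≤ l := by exact_mod_cast h.le
  have hlt' : (l : ℝ) ≤ 128 * t := by exact_mod_cast hlt.le
  have hΛ0 : 0 < Λ := by linarith
  set r := √(l : ℝ) with hr_def
  have hrΛ : 10 ^ 7 * Λ ≤ r := by nlinarith
  have hr0 : 10 ^ 14 ≤ r := by nlinarith
  have hrr : r * r = l := Real.mul_self_sqrt (Nat.cast_nonneg l)
  have hl0 : (0 : ℝ) < l := by nlinarith
  have ht0 : (0 : ℝ) < t := by linarith
  have hs0 : 0 < s := by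
    by_contra hs
    nlinarith
  have hΛr : 10 ^ 7 * (Λ * r) ≤ l := by nlinarith
  have hΛr1 : 10 ^ 21 ≤ Λ * r := by nlinarith
  set σ := l * s with hσ
  set b := t * s with hb
  have hb1 : b ≤ 1 / 8 := le_trans (mul_le_mul_of_nonneg_right htl hs0.le) hs2
  have hb2 : 5 / 8192 ≤ b := by nlinarith
  set X := l * (1 - b) ^ 2 - 1 / 4 - 2 * (Λ * r) with hX
  set Y := t * ((1 - σ) * (1 - b)) + 1 / 4 + 2 * (Λ * r) with hY
  have hX1 : (l : ℝ) / 2 ≤ X := by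
    have : (7 / 8 : ℝ) ^ 2 ≤ (1 - b) ^ 2 := pow_le_pow_left₀ (by norm_num) (by linarith) 2
    nlinarith
  have hXl : X ≤ l * (1 - b) ^ 2 := by linarith
  have hX2 : X < l := by
    have : (1 - b) ^ 2 ≤ 1 := by nlinarith
    nlinarith
  have hY0 : t * (49 / 64) ≤ Y := by
    have : (7 / 8 : ℝ) * (7 / 8) ≤ (1 - σ) * (1 - b) :=
      mul_le_mul (by linarith) (by linarith) (by norm_num) (by linarith)
    nlinarith
  have hXY : X - Y = (1 - b) * (l - t) - 1 / 2 - 4 * (Λ * r) := by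
    rw [hX, hY, hσ, hb]
    ring
  have hf1 : ((⌊X⌋₊ : ℕ) : ℝ) ≤ X := Nat.floor_le (by linarith)
  have hf2 : X - 1 < (⌊X⌋₊ : ℕ) := by linarith [Nat.lt_floor_add_one X]
  have hc1 : Y ≤ (⌈Y⌉₊ : ℕ) := Nat.le_ceil Y
  have hc2 : ((⌈Y⌉₊ : ℕ) : ℝ) < Y + 1 := Nat.ceil_lt_add_one (by linarith)
  refine ⟨⌊X⌋₊, ⌈Y⌉₊, ?_, ⟨?_, ?_⟩, hf1, hc1, fun m hm => ?_⟩
  · exact_mod_cast hf1.trans_lt hX2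
  · have hpos : (0 : ℝ) < (⌊X⌋₊ : ℕ) := by linarith
    have h1b : 0 < 1 - b := by linarith
    have hsq : √((⌊X⌋₊ : ℕ) : ℝ) ≤ (1 - b) * r := by
      rw [Real.sqrt_le_left (by positivity)]
      calc _ ≤ l * (1 - b) ^ 2 := hf1.trans hXl
        _ = _ := by rw [← hrr]; ring
    have hlog : Real.log (⌊X⌋₊ : ℕ) ≤ Real.log l - 2 * b := by
      calc Real.log (⌊X⌋₊ : ℕ) ≤ Real.log (l * (1 - b) ^ 2) :=
            Real.log_le_log hpos (hf1.trans hXl)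
        _ = Real.log l + 2 * Real.log (1 - b) := by
            rw [Real.log_mul hl0.ne' (by positivity), Real.log_pow]
            norm_num
        _ ≤ _ := by linarith [Real.log_le_sub_one_of_pos h1b]
    have hlog0 := Real.log_natCast_nonneg ⌊X⌋₊
    have hprod : Λ ^ 2 * (1 + Real.log (⌊X⌋₊ : ℕ)) * √((⌊X⌋₊ : ℕ) : ℝ) ≤
        Λ ^ 2 * (1 + (Real.log l - 2 * b)) * ((1 - b) * r) :=
      mul_le_mul (mul_le_mul_of_nonneg_left (by linarith) (sq_nonneg Λ)) hsq (Real.sqrt_nonneg _)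
        (mul_nonneg (sq_nonneg Λ) (by linarith))
    have hsplit : Λ ^ 2 * (1 + (Real.log l - 2 * b)) * ((1 - b) * r) =
        (1 - b) * (Λ ^ 2 * (1 + Real.log l) * r) - 2 * Λ ^ 2 * b * ((1 - b) * r) := by ring
    have hgap := mul_le_mul_of_nonneg_left h.1 h1b.le
    have hmain : 4 * (Λ * r) + 5 / 2 ≤ 2 * Λ ^ 2 * b * ((1 - b) * r) := by
      have h1 : 5 / 8192 * (7 / 8) ≤ b * (1 - b) :=
        mul_le_mul hb2 (by linarith) (by norm_num) (by linarith)
      have h2 : 10 ^ 7 * (Λ * r) ≤ Λ ^ 2 * r := by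
        have := mul_le_mul_of_nonneg_right hΛ (show 0 ≤ Λ * r by positivity)
        linarith
      have h3 : 5 / 8192 * (7 / 8) * (Λ ^ 2 * r) ≤ b * (1 - b) * (Λ ^ 2 * r) :=
        mul_le_mul_of_nonneg_right h1 (by positivity)
      have h4 : 2 * Λ ^ 2 * b * ((1 - b) * r) = 2 * (b * (1 - b) * (Λ ^ 2 * r)) := by ring
      linarith
    linarith
  · have h1 : Λ ^ 2 * Λ ^ 2 ≤ l := by
      rw [← hrr]
      exact mul_le_mul hr hr (by positivity) (by linarith)
    have h2 : 10 ^ 7 * Λ ^ 3 ≤ l := by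
      refine le_trans ?_ h1
      have := mul_le_mul_of_nonneg_right hΛ (show 0 ≤ Λ ^ 3 by positivity)
      linarith
    linarith
  · have h1 : l / 128 * (7 / 8) * (5 / 8192) ≤ t * (1 - σ) * b :=
      mul_le_mul (mul_le_mul (by linarith) (by linarith) (by norm_num) ht0.le) hb2 (by norm_num)
        (mul_nonneg ht0.le (by linarith))
    have h2 : t * (1 - σ) ≤ 8 * m * (1 - σ) := mul_le_mul_of_nonneg_right hm (by linarith)
    have h3 : Y = t * (1 - σ) - t * (1 - σ) * b + 1 / 4 + 2 * (Λ * r) := by rw [hY]; ring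
    linarith

end Parameters

lemma GoodParams.exp_le_two_pow {Λ : ℝ} {l t m : ℕ} (h : GoodParams Λ l t) (hΛ : 10 ^ 7 ≤ Λ)
    (hm : t ≤ 8 * m) : 2 ≤ m ∧ 32 * Real.exp Λ ≤ 3 * 2 ^ m := by
  have h1 : (t : ℝ) ≤ 8 * m := by exact_mod_cast hm
  have h2 : 10 ^ 14 * Λ ≤ Λ ^ 3 := by
    have := mul_le_mul hΛ hΛ (by norm_num) (by linarith)
    nlinarith
  have h3 := h.2
  have h4 : (2 : ℝ) ≤ m := by linarith
  refine ⟨by exact_mod_cast h4, ?_⟩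
  have h5 : Real.exp (Λ + 32) ≤ 2 ^ m := by
    calc Real.exp (Λ + 32) ≤ Real.exp (m * Real.log 2) := by
          refine Real.exp_le_exp.2 ?_
          nlinarith [Real.log_two_gt_d9]
      _ = 2 ^ m := by rw [Real.exp_nat_mul, Real.exp_log (by norm_num)]
  rw [Real.exp_add] at h5
  have h6 := Real.add_one_le_exp (32 : ℝ)
  nlinarith [Real.exp_pos Λ]

section Recursion

variable {V β : Type*} [Fintype V] [DecidableEq V] [Fintype β] [DecidableEq β]

/-- A partial colouring can be completed as long as the parameters are good. -/
theorem exists_colouring_of_goodParams [Nonempty β] (G : SimpleGraph V) [DecidableRel G.Adj]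
    {Λ : ℝ} (hΛ : 10 ^ 7 ≤ Λ) (hmax : (G.maxDegree : ℝ) ≤ Real.exp Λ) {l t : ℕ}
    {U : Finset (Sym2 V)} {L : Sym2 V → Finset β} {P : V → Finset β}
    (hU : ∀ e ∈ U, ¬ e.IsDiag) (hgood : GoodParams Λ l t) (hl2 : (l : ℝ) ≤ 2 * Real.exp Λ)
    (hL : ∀ e ∈ U, (L e).card = l) (hc : ∀ v α, cdeg U L v α ≤ t)
    (ht : ∀ v, t ≤ 8 * (edgesAt U v).card) (hP : ∀ e ∈ U, ∀ v ∈ e, Disjoint (L e) (P v)) :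
    ∃ c : Sym2 V → β, (∀ e ∈ U, c e ∈ L e) ∧
      (∀ e ∈ U, ∀ f ∈ U, e ≠ f → ∀ v, v ∈ e → v ∈ f → c e ≠ c f) ∧
      ∀ u v, G.Adj u v → P u ∪ (edgesAt U u).image c ≠ P v ∪ (edgesAt U v).image c := by
  induction l using Nat.strong_induction_on generalizing t U L P with
  | _ l ih =>
  have hlt : l < 128 * t ∨ 128 * t ≤ l := lt_or_ge _ _
  have htpos := hgood.pos hΛ
  have htl := hgood.le
  obtain hlt | hlt := hlt
  swap
  · have hm : ∀ v, (t + 7) / 8 ≤ (edgesAt U v).card := fun v => by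
      have := ht v
      omega
    obtain ⟨hm2, hexp⟩ := hgood.exp_le_two_pow hΛ (m := (t + 7) / 8) (by omega)
    refine exists_colouring_of_large_lists G (by omega) hlt hL hc hP hm2 hm ?_
    have : (32 * G.maxDegree : ℝ) ≤ 3 * 2 ^ ((t + 7) / 8) := by linarith
    exact_mod_cast this
  have hlpos : 0 < l := by omega
  let m := (t + 7) / 8
  have hm : ∀ v, ∃ M ⊆ edgesAt U v, M.card = m := fun v =>
    Finset.exists_subset_card_eq (by have := ht v; omega)
  choose M hMsub hMcard using hm
  obtain ⟨ha, hexp⟩ := concentration_condition hgood hΛ hl2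
  have H := isBoundedLinear_itemInc hlpos htl hL hc
  obtain ⟨l', t', hl'l, hgood', hl', ht', hm'⟩ :=
    exists_next_params hgood hΛ hlt H.le_mul_succProb H.mul_succProb_le
  obtain ⟨U', hU', L', col, hL'L, hcolL, hcol, hcolL', hL', hc', hM'⟩ := exists_colour_step
    (M := M) hU hlpos htl hL hc
    (fun v e he => (mem_edgesAt.1 (hMsub v he)).1) (fun v e he => (mem_edgesAt.1 (hMsub v he)).2)
    (fun v => by rw [hMcard v]; omega) (by positivity) ha hexp
  have htrunc : ∀ e, ∃ N ⊆ L' e, e ∈ U' → N.card = l' := by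
    intro e
    by_cases he : e ∈ U'
    · have : (l' : ℝ) ≤ (L' e).card := hl'.trans (hL' e he)
      obtain ⟨N, hN, hNc⟩ := Finset.exists_subset_card_eq (show l' ≤ (L' e).card by exact_mod_cast this)
      exact ⟨N, hN, fun _ => hNc⟩
    · exact ⟨∅, Finset.empty_subset _, fun h => absurd h he⟩
  choose N hNsub hNcard using htrunc
  let g : Sym2 V → β := fun e => (col e).getD (Classical.arbitrary β)
  have hg : ∀ e ∈ U \ U', g e ∈ L e ∧ col e = some (g e) := by
    intro e he
    obtain ⟨α, hα, h⟩ := hcolL e he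
    simp [g, h, hα]
  let P' : V → Finset β := fun v => P v ∪ (edgesAt (U \ U') v).image g
  obtain ⟨c, hcL, hcprop, hcpal⟩ := ih l' hl'l (t := t') (U := U') (L := N) (P := P')
    (fun e he => hU e (hU' he)) hgood' (le_trans (by exact_mod_cast hl'l.le) hl2) (fun e he => hNcard e he)
    (fun v α => by
      have h1 : cdeg U' N v α ≤ cdeg U' L' v α := Finset.card_le_card fun e he => by
        rw [Finset.mem_filter] at he ⊢
        exact ⟨he.1, he.2.1, hNsub e he.2.2⟩
      have h2 : (cdeg U' L' v α : ℝ) ≤ t' := (hc' v α).trans ht'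
      exact h1.trans (by exact_mod_cast h2))
    (fun v => by
      have h1 : M v ∩ U' ⊆ edgesAt U' v := fun e he => by
        rw [Finset.mem_inter] at he
        exact mem_edgesAt.2 ⟨he.2, (mem_edgesAt.1 (hMsub v he.1)).2⟩
      have h2 := Finset.card_le_card h1
      have h3 : (t : ℝ) ≤ 8 * m := by
        have : t ≤ 8 * m := by omega
        exact_mod_cast this
      have h4 := hm' m h3
      have h5 := hM' v
      rw [hMcard v] at h5
      have h6 : (t' : ℝ) ≤ 8 * (M v ∩ U').card := by linarith
      have h7 : t' ≤ 8 * (M v ∩ U').card := by exact_mod_cast h6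
      omega)
    (fun e he v hv => by
      rw [Finset.disjoint_union_right]
      refine ⟨(hP e (hU' he) v hv).mono_left ((hNsub e).trans (hL'L e)), ?_⟩
      rw [Finset.disjoint_left]
      intro α hα hα'
      obtain ⟨f, hf, rfl⟩ := Finset.mem_image.1 hα'
      rw [mem_edgesAt] at hf
      exact hcolL' e he _ (hNsub e hα) f hf.1 v hv hf.2 (hg f hf.1).2)
  let c' : Sym2 V → β := fun e => if e ∈ U' then c e else g e
  have hcU : ∀ e ∈ U', c' e = c e := fun e he => if_pos he
  have hcg : ∀ e ∈ U \ U', c' e = g e := fun e he => if_neg (Finset.mem_sdiff.1 he).2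
  have hcases : ∀ e ∈ U, e ∈ U' ∨ e ∈ U \ U' := fun e he => by
    rw [Finset.mem_sdiff]
    tauto
  have hmixed : ∀ e ∈ U', ∀ f ∈ U \ U', ∀ v, v ∈ e → v ∈ f → c e ≠ g f := by
    intro e he f hf v hve hvf h
    refine hcolL' e he _ (hNsub e (hcL e he)) f hf v hve hvf ?_
    rw [h, (hg f hf).2]
  have himage : ∀ v, P v ∪ (edgesAt U v).image c' = P' v ∪ (edgesAt U' v).image c := by
    intro v
    have h1 : edgesAt U v = edgesAt (U \ U') v ∪ edgesAt U' v := by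
      ext e
      simp only [Finset.mem_union, mem_edgesAt, Finset.mem_sdiff]
      have := @hU' e
      tauto
    rw [h1, Finset.image_union, ← Finset.union_assoc,
      Finset.image_congr (f := c') (g := g) fun e he => hcg e (mem_edgesAt.1 he).1,
      Finset.image_congr (f := c') (g := c) fun e he => hcU e (mem_edgesAt.1 he).1]
  refine ⟨c', fun e he => ?_, fun e he f hf hef v hve hvf => ?_, fun u v huv => ?_⟩
  · rcases hcases e he with h | h
    · rw [hcU e h]
      exact hL'L e (hNsub e (hcL e h))
    · rw [hcg e h]
      exact (hg e h).1
  · rcases hcases e he with h | h <;> rcases hcases f hf with h' | h'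
    · rw [hcU e h, hcU f h']
      exact hcprop e h f h' hef v hve hvf
    · rw [hcU e h, hcg f h']
      exact hmixed e h f h' v hve hvf
    · rw [hcg e h, hcU f h']
      exact (hmixed f h' e h v hvf hve).symm
    · rw [hcg e h, hcg f h']
      intro hgg
      refine hcol e h f h' hef v hve hvf ?_
      rw [(hg e h).2, (hg f h').2, hgg]
  · rw [himage u, himage v]
    exact hcpal u v huv

end Recursion

/-- The initial parameters are good. -/
lemma goodParams_initial {D : ℕ} (hD : Real.exp (10 ^ 7) ≤ D) :
    10 ^ 7 ≤ Real.log D ∧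
      GoodParams (Real.log D) (D + ⌊√(D : ℝ) * Real.log D ^ 4⌋₊) D ∧
      ((D + ⌊√(D : ℝ) * Real.log D ^ 4⌋₊ : ℕ) : ℝ) ≤ 2 * D := by
  have hD0 : (0 : ℝ) < D := (Real.exp_pos _).trans_le hD
  set Λ := Real.log D with hΛ_def
  have hΛ : 10 ^ 7 ≤ Λ := (Real.le_log_iff_exp_le hD0).2 hD
  have hΛ0 : 0 < Λ := by linarith
  set r := √(D : ℝ) with hr_def
  have hr0 : 0 < r := Real.sqrt_pos.2 hD0
  have hrr : r * r = D := Real.mul_self_sqrt hD0.le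
  have hexp : Real.exp (Λ / 2) = r := by
    rw [hr_def, ← Real.exp_log hD0, Real.exp_half]
  have hr : Λ ^ 4 ≤ r := by
    rw [← hexp]
    have h1 := Real.pow_div_factorial_le_exp (x := Λ / 2) (by positivity) 5
    refine le_trans ?_ h1
    have h2 : 10 ^ 7 * Λ ^ 4 ≤ Λ * Λ ^ 4 := mul_le_mul_of_nonneg_right hΛ (by positivity)
    have h3 : (Nat.factorial 5 : ℝ) = 120 := by norm_num [Nat.factorial]
    rw [h3]
    have h4 : 0 < Λ ^ 4 := by positivity
    nlinarith
  set F := ⌊r * Λ ^ 4⌋₊ with hF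
  have hF1 : (F : ℝ) ≤ r * Λ ^ 4 := Nat.floor_le (by positivity)
  have hF2 : r * Λ ^ 4 - 1 ≤ F := by linarith [Nat.lt_floor_add_one (r * Λ ^ 4)]
  have hl : ((D + F : ℕ) : ℝ) ≤ 2 * D := by
    push_cast
    have := mul_le_mul_of_nonneg_left hr hr0.le
    linarith
  have hlpos : (0 : ℝ) < ((D + F : ℕ) : ℝ) := by
    push_cast
    positivity
  refine ⟨hΛ, ⟨?_, ?_⟩, hl⟩
  · have hlog : Real.log ((D + F : ℕ) : ℝ) ≤ Λ + 1 := by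
      refine (Real.log_le_log hlpos hl).trans ?_
      rw [Real.log_mul (by norm_num) hD0.ne']
      linarith [Real.log_two_lt_d9]
    have hsqrt : √((D + F : ℕ) : ℝ) ≤ 2 * r := by
      rw [Real.sqrt_le_left (by positivity)]
      nlinarith
    have hlog0 := Real.log_natCast_nonneg (D + F)
    have h1 : Λ ^ 2 * (1 + Real.log ((D + F : ℕ) : ℝ)) * √((D + F : ℕ) : ℝ) ≤
        Λ ^ 2 * (1 + (Λ + 1)) * (2 * r) := by
      gcongr
    refine h1.trans ?_
    push_cast
    have h2 : Λ ^ 2 * (1 + (Λ + 1)) * (2 * r) ≤ 4 * (Λ ^ 3 * r) := by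
      have : Λ ^ 2 * (1 + (Λ + 1)) ≤ Λ ^ 2 * (2 * Λ) :=
        mul_le_mul_of_nonneg_left (by linarith) (by positivity)
      nlinarith
    have h3 : 10 ^ 7 * (Λ ^ 3 * r) ≤ r * Λ ^ 4 := by
      have := mul_le_mul_of_nonneg_right hΛ (show 0 ≤ Λ ^ 3 * r by positivity)
      linarith
    have h4 : 1 ≤ Λ ^ 3 * r := by
      have h5 : 1 ≤ Λ ^ 3 := one_le_pow₀ (by linarith)
      have h6 : 1 ≤ r := (one_le_pow₀ (by linarith)).trans hr
      nlinarith
    linarith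
  · have h1 : Λ ^ 3 ≤ Λ ^ 4 := pow_le_pow_right₀ (by linarith) (by norm_num)
    have h2 : 1 ≤ r := (one_le_pow₀ (by linarith)).trans hr
    nlinarith

end AVD

/-- There are constants `C₀ > 0` and `Δ₀` such that every finite simple graph `G`
with maximum degree `Δ ≥ Δ₀` and minimum degree `δ ≥ Δ/4` admits an adjacent vertex
distinguishing edge colouring from any lists of size at least
`Δ + ⌊C₀·Δ^(1/2)·(log Δ)^4⌋` on the edges. -/
theorem avd_edge_choosability_min_degree :
    ∃ (C₀ : ℝ) (Δ₀ : ℕ), 0 < C₀ ∧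
      ∀ (V β : Type) [Fintype V] [DecidableEq V] [DecidableEq β]
        (G : SimpleGraph V) [DecidableRel G.Adj] (L : Sym2 V → Finset β),
        -- maximum degree at least Δ₀
        Δ₀ ≤ G.maxDegree →
        -- minimum degree at least Δ/4
        (∀ v : V, (G.maxDegree : ℝ) / 4 ≤ (G.degree v : ℝ)) →
        -- lists are large enough
        (∀ e ∈ G.edgeFinset,
          G.maxDegree + ⌊C₀ * Real.sqrt (G.maxDegree) * (Real.log (G.maxDegree)) ^ 4⌋₊
            ≤ (L e).card) →
        ∃ c : Sym2 V → β,
          -- colours chosen from the lists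
          (∀ e ∈ G.edgeFinset, c e ∈ L e) ∧
          -- proper edge colouring
          (∀ e ∈ G.edgeFinset, ∀ f ∈ G.edgeFinset,
            e ≠ f → (∃ w : V, w ∈ e ∧ w ∈ f) → c e ≠ c f) ∧
          -- adjacent vertices have distinct palettes
          (∀ u v : V, G.Adj u v →
            (G.incidenceFinset u).image c ≠ (G.incidenceFinset v).image c) := by
  refine ⟨1, ⌈Real.exp (10 ^ 7)⌉₊, one_pos, ?_⟩
  intro V β _ _ _ G _ L hmax hmin hlist
  have hD : Real.exp (10 ^ 7) ≤ G.maxDegree := (Nat.le_ceil _).trans (by exact_mod_cast hmax)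
  obtain ⟨hΛ, hgood, hl⟩ := AVD.goodParams_initial hD
  simp only [one_mul] at hlist
  set l := G.maxDegree + ⌊√(G.maxDegree : ℝ) * Real.log G.maxDegree ^ 4⌋₊
  have hD0 : (0 : ℝ) < G.maxDegree := (Real.exp_pos _).trans_le hD
  have hedges : ∀ v, AVD.edgesAt G.edgeFinset v = G.incidenceFinset v := fun v =>
    (G.incidenceFinset_eq_filter v).symm
  have hdeg : ∀ v, (AVD.edgesAt G.edgeFinset v).card = G.degree v := fun v => by
    rw [hedges, G.card_incidenceFinset_eq_degree]
  have htrunc : ∀ e, ∃ N ⊆ L e, e ∈ G.edgeFinset → N.card = l := by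
    intro e
    by_cases he : e ∈ G.edgeFinset
    · obtain ⟨N, hN, hNc⟩ := Finset.exists_subset_card_eq (hlist e he)
      exact ⟨N, hN, fun _ => hNc⟩
    · exact ⟨∅, Finset.empty_subset _, fun h => absurd h he⟩
  choose N hNL hNcard using htrunc
  let S : Finset β := Finset.univ.biUnion L
  have hNS : ∀ e, ∀ α ∈ N e, α ∈ S := fun e α hα =>
    Finset.mem_biUnion.2 ⟨e, Finset.mem_univ _, hNL e hα⟩
  have hne : Nonempty S := by
    have h1 : G.edgeFinset.Nonempty := by
      rw [Finset.nonempty_iff_ne_empty]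
      intro h
      have h2 : G.maxDegree ≤ 0 := G.maxDegree_le_of_forall_degree_le 0 fun v => by
        rw [← hdeg v, h]
        simp [AVD.edgesAt]
      have h3 : 0 < G.maxDegree := by exact_mod_cast hD0
      omega
    obtain ⟨e, he⟩ := h1
    have h2 : 0 < (N e).card := by
      rw [hNcard e he]
      exact (hgood.pos hΛ).trans_le hgood.le
    obtain ⟨α, hα⟩ := Finset.card_pos.1 h2
    exact ⟨⟨α, hNS e α hα⟩⟩
  obtain ⟨c, hcN, hprop, hpal⟩ := AVD.exists_colouring_of_goodParams (β := S) G hΛ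
    (Real.exp_log hD0).ge (l := l) (t := G.maxDegree) (U := G.edgeFinset)
    (L := fun e => (N e).subtype (· ∈ S)) (P := fun _ => ∅)
    (fun e he => G.not_isDiag_of_mem_edgeFinset he) hgood
    (by rwa [Real.exp_log hD0])
    (fun e he => by
      rw [Finset.card_subtype, Finset.filter_true_of_mem (hNS e), hNcard e he])
    (fun v α => by
      refine le_trans ?_ (G.degree_le_maxDegree v)
      rw [← hdeg v]
      exact Finset.card_le_card fun e he =>
        AVD.mem_edgesAt.2 ⟨(Finset.mem_filter.1 he).1, (Finset.mem_filter.1 he).2.1⟩)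
    (fun v => by
      have h1 := hmin v
      have h2 : (G.maxDegree : ℝ) ≤ (4 * G.degree v : ℕ) := by
        push_cast
        linarith
      have h3 : G.maxDegree ≤ 4 * G.degree v := by exact_mod_cast h2
      rw [hdeg v]
      omega)
    (fun e _ v _ => Finset.disjoint_empty_right _)
  refine ⟨fun e => c e, fun e he => hNL e (Finset.mem_subtype.1 (hcN e he)), ?_, ?_⟩
  · rintro e he f hf hef ⟨w, hwe, hwf⟩ h
    exact hprop e he f hf hef w hwe hwf (Subtype.ext h)
  · intro u v huv h
    refine hpal u v huv ?_
    simp only [Finset.empty_union, hedges]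
    refine Finset.image_injective Subtype.val_injective ?_
    simpa only [Finset.image_image] using! h
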